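/- For every integer d ≥ 2 there exist constants C > 0 and c > 0 such that for every integer n ≥ 0 one has c·exp(−C·n^{d/(d+2)}·(log(n+2))^{2/(d+2)}) ≤ p_{2n}(ℤ^d) ≤ C·exp(−c·n^{d/(d+2)}). -/

import Mathlib

open scoped BigOperators

/-- Points of `ℤ^d`. -/
abbrev Vtx (d : ℕ) := Fin d → ℤ

/-- The `ℓ¹` distance on `ℤ^d`. -/
def dist1 {d : ℕ} (x y : Vtx d) : ℕ := ∑ i, (x i - y i).natAbs

/-- `x : Fin (n+1) → ℤ^d` is a path of length `n` (nearest-neighbour steps). -/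
def IsPath {d n : ℕ} (x : Fin (n + 1) → Vtx d) : Prop :=
  ∀ i : Fin n, dist1 (x i.succ) (x i.castSucc) = 1

/-- The transposition product `(x₀ x₁)∘(x₁ x₂)∘⋯∘(x_{n-1} x_n)`. -/
def transProd {d n : ℕ} (x : Fin (n + 1) → Vtx d) : Equiv.Perm (Vtx d) :=
  ((List.finRange n).map (fun i => Equiv.swap (x i.castSucc) (x i.succ))).prod

/-- The number of paths of length `n` in `ℤ^d`, starting at `x₀`, staying in `B`,
with identity transposition product. -/
noncomputable def numPathsIn (d n : ℕ) (B : Set (Vtx d)) (x₀ : Vtx d) : ℕ :=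
  Nat.card {x : Fin (n + 1) → Vtx d //
    IsPath x ∧ x 0 = x₀ ∧ (∀ i, x i ∈ B) ∧ transProd x = 1}

/-- `T n d`: the number of paths of length `n` in `ℤ^d` starting at the origin whose
transposition product is the identity. -/
noncomputable def T (n d : ℕ) : ℕ := numPathsIn d n Set.univ 0

namespace MonoidAlgebra

variable {G : Type*} [Group G]

/-- A real group algebra element whose coefficients are invariant under inversion. -/
def InvSymm (x : MonoidAlgebra ℝ G) : Prop := ∀ g, x.coeff g⁻¹ = x.coeff g

/-- The augmentation of the real group algebra. -/
noncomputable def mass : MonoidAlgebra ℝ G →ₐ[ℝ] ℝ := MonoidAlgebra.lift ℝ ℝ G 1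

theorem mass_single (g : G) (r : ℝ) : mass (single g r) = r := by
  simp [mass]

theorem mass_eq_sum (x : MonoidAlgebra ℝ G) : mass x = x.coeff.sum fun _ r => r := by
  induction x using MonoidAlgebra.induction_linear with
  | zero => simp
  | add x y hx hy => rw [map_add, hx, hy, coeff_add, Finsupp.sum_add_index'] <;> simp
  | single g r => simp [mass_single]

theorem coeff_mul_one_comm (x y : MonoidAlgebra ℝ G) : (x * y).coeff 1 = (y * x).coeff 1 := by
  rw [coeff_mul_apply_left, coeff_mul_apply_right]
  simp [mul_comm]

theorem coeff_mul_inv {x y : MonoidAlgebra ℝ G} (hx : InvSymm x) (hy : InvSymm y) (g : G) :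
    (x * y).coeff g⁻¹ = (y * x).coeff g := by
  classical
  rw [coeff_mul_apply_left, coeff_mul_apply_right, Finsupp.sum, Finsupp.sum]
  refine Finset.sum_nbij' (fun h => h⁻¹) (fun h => h⁻¹) ?_ ?_ ?_ ?_ ?_
  · intro h hh; simpa [hx h] using hh
  · intro h hh; simpa [hx h] using hh
  · simp
  · simp
  · intro h _
    rw [← mul_inv_rev, hy, hx h, inv_inv, mul_comm]

theorem InvSymm.one : InvSymm (1 : MonoidAlgebra ℝ G) := by
  classical
  intro g
  simp only [one_def, coeff_single, Finsupp.single_apply, eq_comm (a := (1 : G)), inv_eq_one]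

theorem InvSymm.add {x y : MonoidAlgebra ℝ G} (hx : InvSymm x) (hy : InvSymm y) :
    InvSymm (x + y) := fun g => by simp [hx g, hy g]

theorem InvSymm.smul {x : MonoidAlgebra ℝ G} (r : ℝ) (hx : InvSymm x) :
    InvSymm (r • x) := fun g => by simp [hx g]

theorem InvSymm.sub {x y : MonoidAlgebra ℝ G} (hx : InvSymm x) (hy : InvSymm y) :
    InvSymm (x - y) := fun g => by simp [hx g, hy g]

theorem InvSymm.pow {x : MonoidAlgebra ℝ G} (hx : InvSymm x) (n : ℕ) : InvSymm (x ^ n) := by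
  induction n with
  | zero => simpa using InvSymm.one
  | succ n ih => intro g; rw [pow_succ, coeff_mul_inv ih hx, ← pow_succ', pow_succ]

theorem coeff_mul_self_one {y : MonoidAlgebra ℝ G} (hy : InvSymm y) :
    (y * y).coeff 1 = ∑ h ∈ y.coeff.support, y.coeff h ^ 2 := by
  rw [coeff_mul_apply_left, Finsupp.sum]
  refine Finset.sum_congr rfl fun h _ => ?_
  rw [mul_one, hy, sq]

theorem coeff_mul_single_mul_one_le {y : MonoidAlgebra ℝ G} (hy : InvSymm y) (s : G) :
    (y * single s 1 * y).coeff 1 ≤ (y * y).coeff 1 := by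
  classical
  have h1 : ∑ h ∈ y.coeff.support, y.coeff (h * s) ^ 2 ≤ ∑ h ∈ y.coeff.support, y.coeff h ^ 2 := by
    rw [← Finset.sum_image (s := y.coeff.support) (g := fun h => h * s)
      (f := fun k => y.coeff k ^ 2) (by intro a _ b _ h; exact mul_right_cancel h)]
    refine (Finset.sum_le_sum_of_subset_of_nonneg (Finset.subset_union_left
      (s₂ := y.coeff.support)) (fun _ _ _ => sq_nonneg _)).trans_eq ?_
    refine (Finset.sum_subset Finset.subset_union_right fun k _ hk => ?_).symm
    simp [Finsupp.notMem_support_iff.1 hk]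
  rw [mul_assoc, coeff_mul_self_one hy, coeff_mul_apply_left, Finsupp.sum]
  calc ∑ h ∈ y.coeff.support, y.coeff h * (single s 1 * y).coeff (h⁻¹ * 1)
      = ∑ h ∈ y.coeff.support, y.coeff h * y.coeff (h * s) := by
        refine Finset.sum_congr rfl fun h _ => ?_
        rw [mul_one, coeff_single_mul_apply, one_mul, ← mul_inv_rev, hy]
    _ ≤ ∑ h ∈ y.coeff.support, (y.coeff h ^ 2 / 2 + y.coeff (h * s) ^ 2 / 2) :=
        Finset.sum_le_sum fun h _ => by nlinarith [sq_nonneg (y.coeff h - y.coeff (h * s))]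
    _ = (∑ h ∈ y.coeff.support, y.coeff h ^ 2) / 2 +
        (∑ h ∈ y.coeff.support, y.coeff (h * s) ^ 2) / 2 := by
        rw [Finset.sum_add_distrib, Finset.sum_div, Finset.sum_div]
    _ ≤ _ := by linarith

theorem coeff_mul_mul_one_eq_sum (y r : MonoidAlgebra ℝ G) :
    (y * r * y).coeff 1 = r.coeff.sum fun s a => a * (y * single s 1 * y).coeff 1 := by
  induction r using MonoidAlgebra.induction_linear with
  | zero => simp
  | add u v hu hv =>
    rw [mul_add, add_mul, coeff_add, Finsupp.add_apply, hu, hv, coeff_add, Finsupp.sum_add_index']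
    · simp
    · intros; ring
  | single s a =>
    have : (single s a : MonoidAlgebra ℝ G) = a • single s 1 := by simp
    rw [this, mul_smul_comm, smul_mul_assoc, coeff_smul_apply, smul_single, coeff_single]
    simp

theorem coeff_mul_mul_one_le {y r : MonoidAlgebra ℝ G} (hy : InvSymm y)
    (hr : ∀ g, 0 ≤ r.coeff g) : (y * r * y).coeff 1 ≤ mass r * (y * y).coeff 1 := by
  rw [coeff_mul_mul_one_eq_sum, mass_eq_sum, Finsupp.sum, Finsupp.sum, Finset.sum_mul]
  exact Finset.sum_le_sum fun s _ =>
    mul_le_mul_of_nonneg_left (coeff_mul_single_mul_one_le hy s) (hr s)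

theorem coeff_mul_nonneg {x y : MonoidAlgebra ℝ G} (hx : ∀ g, 0 ≤ x.coeff g)
    (hy : ∀ g, 0 ≤ y.coeff g) (g : G) : 0 ≤ (x * y).coeff g := by
  rw [coeff_mul_apply_left]
  exact Finset.sum_nonneg fun h _ => mul_nonneg (hx h) (hy _)

theorem coeff_pow_nonneg {x : MonoidAlgebra ℝ G} (hx : ∀ g, 0 ≤ x.coeff g) (n : ℕ) :
    ∀ g, 0 ≤ (x ^ n).coeff g := by
  classical
  induction n with
  | zero => intro g; rw [pow_zero, one_def, coeff_single, Finsupp.single_apply]; split_ifs <;> norm_num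
  | succ n ih => rw [pow_succ]; exact coeff_mul_nonneg ih hx

theorem coeff_pow_one_antitone {q : MonoidAlgebra ℝ G} (hq : InvSymm q)
    (hq0 : ∀ g, 0 ≤ q.coeff g) (hq1 : mass q = 1) :
    Antitone fun n : ℕ => (q ^ (2 * n)).coeff 1 := by
  refine antitone_nat_of_succ_le fun n => ?_
  have := coeff_mul_mul_one_le (hq.pow n) (coeff_pow_nonneg hq0 2)
  rw [map_pow, hq1, one_pow, one_mul, ← pow_add, ← pow_add, ← pow_add] at this
  rw [show 2 * (n + 1) = n + 2 + n by ring, show 2 * n = n + n by ring]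
  exact this

theorem coeff_pow_one_le_one {q : MonoidAlgebra ℝ G} (hq : InvSymm q)
    (hq0 : ∀ g, 0 ≤ q.coeff g) (hq1 : mass q = 1) (n : ℕ) : (q ^ (2 * n)).coeff 1 ≤ 1 := by
  simpa using coeff_pow_one_antitone hq hq0 hq1 (Nat.zero_le n)

/-- The formal derivative of `t ↦ (a + t d) ^ n`. -/
noncomputable def powDeriv (x d : MonoidAlgebra ℝ G) : ℕ → MonoidAlgebra ℝ G
  | 0 => 0
  | n + 1 => powDeriv x d n * x + x ^ n * d

theorem powDeriv_mul_coeff_one (x d : MonoidAlgebra ℝ G) (n k : ℕ) :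
    (powDeriv x d n * x ^ (k + 1)).coeff 1 = n * (x ^ (n + k) * d).coeff 1 := by
  induction n generalizing k with
  | zero => simp [powDeriv]
  | succ n ih =>
    rw [powDeriv, add_mul, mul_assoc, ← pow_succ', coeff_add, Finsupp.add_apply, ih,
      coeff_mul_one_comm (x ^ n * d), ← mul_assoc, ← pow_add]
    rw [show n + (k + 1) = n + 1 + k by ring, show k + 1 + n = n + 1 + k by ring]
    push_cast
    ring

theorem powDeriv_succ_coeff_one (x d : MonoidAlgebra ℝ G) (n : ℕ) :
    (powDeriv x d (n + 1)).coeff 1 = (n + 1) * (x ^ n * d).coeff 1 := by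
  have := powDeriv_mul_coeff_one x d n 0
  rw [powDeriv, coeff_add, Finsupp.add_apply]
  simp only [zero_add, pow_one, add_zero] at this
  rw [this]
  ring

theorem hasDerivAt_coeff_pow (a d : MonoidAlgebra ℝ G) (t : ℝ) (n : ℕ) (g : G) :
    HasDerivAt (fun t : ℝ => ((a + t • d) ^ n).coeff g)
      ((powDeriv (a + t • d) d n).coeff g) t := by
  induction n generalizing g with
  | zero => simpa [powDeriv] using hasDerivAt_const t ((1 : MonoidAlgebra ℝ G).coeff g)
  | succ n ih =>
    have key : ∀ z : MonoidAlgebra ℝ G, HasDerivAt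
        (fun t : ℝ => ((a + t • d) ^ n * z).coeff g)
        ((powDeriv (a + t • d) d n * z).coeff g) t := by
      intro z
      simp only [coeff_mul_apply_right, Finsupp.sum]
      exact HasDerivAt.fun_sum fun h _ => (ih _).mul_const _
    have h2 := (key a).add ((hasDerivAt_id t).mul (key d))
    refine (h2.congr_deriv ?_).congr_of_eventuallyEq (Filter.Eventually.of_forall fun s => ?_)
    · simp only [powDeriv, mul_add, coeff_add, Finsupp.add_apply, mul_smul_comm, coeff_smul_apply,
        smul_eq_mul, id]
      ring
    · simp only [pow_succ, mul_add, coeff_add, Finsupp.add_apply, mul_smul_comm, coeff_smul_apply,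
        smul_eq_mul, Pi.add_apply, Pi.mul_apply, id]

/-- Monotonicity of `x ↦ τ (x ^ n)` for odd `n`, where `τ` is the canonical trace. -/
theorem coeff_odd_pow_one_mono {a d : MonoidAlgebra ℝ G} (ha : InvSymm a) (hd : InvSymm d)
    (hpos : ∀ y : MonoidAlgebra ℝ G, InvSymm y → 0 ≤ (y * d * y).coeff 1) (m : ℕ) :
    (a ^ (2 * m + 1)).coeff 1 ≤ ((a + d) ^ (2 * m + 1)).coeff 1 := by
  have hmono : Monotone fun t : ℝ => ((a + t • d) ^ (2 * m + 1)).coeff 1 := by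
    refine monotone_of_deriv_nonneg
      (fun t => (hasDerivAt_coeff_pow a d t _ 1).differentiableAt) fun t => ?_
    rw [(hasDerivAt_coeff_pow a d t _ 1).deriv, powDeriv_succ_coeff_one]
    refine mul_nonneg (by positivity) ?_
    rw [two_mul, pow_add, mul_assoc, coeff_mul_one_comm]
    exact hpos _ ((ha.add (hd.smul t)).pow m)
  simpa using hmono zero_le_one

theorem coeff_pow_one_le_of_smul_le {q p : MonoidAlgebra ℝ G} (hq : InvSymm q) (hp : InvSymm p)
    (hq1 : mass q = 1) (hp1 : mass p = 1) {k : ℕ} {c : ℝ}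
    (h : ∀ g, c * p.coeff g ≤ (q ^ k).coeff g) (m : ℕ) :
    (q ^ (k * (2 * m + 1))).coeff 1 ≤ ∑ N ∈ Finset.range (2 * m + 1 + 1),
      c ^ N * (1 - c) ^ (2 * m + 1 - N) * (2 * m + 1).choose N * (p ^ N).coeff 1 := by
  have hr : InvSymm (q ^ k - c • p) := (hq.pow k).sub (hp.smul c)
  have hmass : mass (q ^ k - c • p) = 1 - c := by simp [hq1, hp1]
  have key := coeff_odd_pow_one_mono (a := q ^ k) (d := (1 - c) • 1 - (q ^ k - c • p))
    (hq.pow k) ((InvSymm.one.smul _).sub hr) (fun y hy => by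
      have h1 := coeff_mul_mul_one_le hy (r := q ^ k - c • p)
        (fun g => by simpa using h g)
      rw [hmass] at h1
      rw [mul_sub, sub_mul, coeff_sub, Finsupp.sub_apply, mul_smul_comm, smul_mul_assoc, mul_one,
        coeff_smul_apply, smul_eq_mul]
      linarith) m
  rw [← pow_mul] at key
  refine key.trans_eq ?_
  rw [show q ^ k + ((1 - c) • 1 - (q ^ k - c • p)) = c • p + (1 - c) • (1 : MonoidAlgebra ℝ G) by
    abel, Commute.add_pow (((Commute.one_right p).smul_left c).smul_right (1 - c)), coeff_sum, Finsupp.finsetSum_apply]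
  refine Finset.sum_congr rfl fun N _ => ?_
  rw [← nsmul_eq_mul', smul_pow, smul_pow, one_pow, mul_smul_comm, mul_one, smul_smul,
    coeff_smul, Finsupp.smul_apply, coeff_smul_apply, smul_eq_mul, nsmul_eq_mul]
  ring

/-- The uniform average of the group elements `f i`. -/
noncomputable def unif {ι : Type*} [Fintype ι] (f : ι → G) : MonoidAlgebra ℝ G :=
  (Fintype.card ι : ℝ)⁻¹ • ∑ i, single (f i) 1

section Unif

variable {ι κ : Type*} [Fintype ι] [Fintype κ]

theorem coeff_unif_mul (f : ι → G) (x : MonoidAlgebra ℝ G) (g : G) :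
    (unif f * x).coeff g = (Fintype.card ι : ℝ)⁻¹ * ∑ i, x.coeff ((f i)⁻¹ * g) := by
  rw [unif, smul_mul_assoc, coeff_smul_apply, Finset.sum_mul, coeff_sum, Finsupp.finsetSum_apply,
    smul_eq_mul]
  simp

theorem coeff_unif [DecidableEq G] (f : ι → G) (g : G) :
    (unif f).coeff g = (Fintype.card ι : ℝ)⁻¹ * ∑ i, if f i = g then 1 else 0 := by
  rw [unif, coeff_smul_apply, coeff_sum, Finsupp.finsetSum_apply, smul_eq_mul]
  simp only [coeff_single, Finsupp.single_apply]

theorem coeff_unif_nonneg (f : ι → G) (g : G) : 0 ≤ (unif f).coeff g := by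
  classical
  rw [coeff_unif]
  positivity

theorem mass_unif [Nonempty ι] (f : ι → G) : mass (unif f) = 1 := by
  simp [unif, mass_single]

theorem unif_mul_unif (f : ι → G) (f' : κ → G) :
    unif f * unif f' = unif fun p : ι × κ => f p.1 * f' p.2 := by
  simp only [unif, smul_mul_smul_comm, Finset.sum_mul_sum, single_mul_single, mul_one,
    Fintype.card_prod, Fintype.sum_prod_type, Nat.cast_mul, mul_inv]

theorem unif_comp_equiv (f : ι → G) (e : κ ≃ ι) : unif (f ∘ e) = unif f := by
  simp only [unif, Fintype.card_congr e, Function.comp_def]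
  rw [e.sum_comp fun i => single (f i) (1 : ℝ)]

theorem InvSymm.unif (f : ι → G) (e : ι ≃ ι) (h : ∀ i, f (e i) = (f i)⁻¹) :
    InvSymm (unif f) := by
  classical
  intro g
  rw [coeff_unif, coeff_unif, ← e.sum_comp]
  simp only [h, inv_inj]

theorem coeff_unif_le_one (f : ι → G) (g : G) : (MonoidAlgebra.unif f).coeff g ≤ 1 := by
  classical
  rw [coeff_unif]
  have : ∑ i : ι, (if f i = g then (1 : ℝ) else 0) ≤ Fintype.card ι := by
    calc _ ≤ ∑ i : ι, (1 : ℝ) := Finset.sum_le_sum fun i _ => by split_ifs <;> norm_num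
      _ = _ := by simp
  rcases Nat.eq_zero_or_pos (Fintype.card ι) with h | h
  · simp [h]
  · rw [inv_mul_le_iff₀ (by positivity)]
    linarith

theorem inv_card_pow_le_coeff_unif_pow (f : ι → G) (w : List ι) :
    ((Fintype.card ι : ℝ)⁻¹) ^ w.length ≤
      (MonoidAlgebra.unif f ^ w.length).coeff (w.map f).prod := by
  classical
  induction w with
  | nil => simp
  | cons i w ih =>
    rw [List.length_cons, pow_succ', pow_succ', coeff_unif_mul]
    refine mul_le_mul_of_nonneg_left (ih.trans ?_) (by positivity)
    have := Finset.single_le_sum (f := fun j => (MonoidAlgebra.unif f ^ w.length).coeff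
      ((f j)⁻¹ * (List.map f (i :: w)).prod))
      (fun j _ => coeff_pow_nonneg (coeff_unif_nonneg f) _ _) (Finset.mem_univ i)
    simpa using this

theorem coeff_unif_le_unif_pow (f : ι → G) (f' : κ → G) (n : ℕ)
    (h : ∀ j, ∃ w : List ι, w.length = n ∧ (w.map f).prod = f' j) (g : G) :
    ((Fintype.card ι : ℝ)⁻¹) ^ n * (MonoidAlgebra.unif f').coeff g ≤
      (MonoidAlgebra.unif f ^ n).coeff g := by
  classical
  by_cases hg : ∃ j, f' j = g
  · obtain ⟨j, rfl⟩ := hg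
    obtain ⟨w, rfl, hw⟩ := h j
    rw [← hw]
    exact (mul_le_of_le_one_right (by positivity) (coeff_unif_le_one _ _)).trans
      (inv_card_pow_le_coeff_unif_pow f w)
  · have : (MonoidAlgebra.unif f').coeff g = 0 := by
      rw [coeff_unif]
      simp only [not_exists] at hg
      simp [hg]
    rw [this, mul_zero]
    exact coeff_pow_nonneg (coeff_unif_nonneg f) _ _

end Unif

theorem coeff_mul_pow_one_comm (x y : MonoidAlgebra ℝ G) (n : ℕ) :
    ((x * y) ^ n).coeff 1 = ((y * x) ^ n).coeff 1 := by
  cases n with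
  | zero => simp
  | succ n =>
    have : ∀ n : ℕ, (x * y) ^ n * x = x * (y * x) ^ n := fun n => by
      induction n with
      | zero => simp
      | succ n ih => rw [pow_succ', mul_assoc, ih, pow_succ']; simp only [mul_assoc]
    rw [pow_succ, ← mul_assoc, this, coeff_mul_one_comm, ← mul_assoc, ← pow_succ']

end MonoidAlgebra

namespace Umpteen

variable {d : ℕ}

/-- The directions of the moves of the blank: an axis and an orientation. -/
abbrev Dir (d : ℕ) := Fin d × Bool

/-- The unit vector of a direction. -/
def vec (e : Dir d) : Vtx d := Pi.single e.1 (if e.2 then 1 else -1)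

/-- The opposite direction. -/
def opp (e : Dir d) : Dir d := (e.1, !e.2)

/-- The `ℓ¹` norm on `ℤ^d`. -/
def nrm (v : Vtx d) : ℕ := ∑ i, (v i).natAbs

/-- A move of the puzzle, in the coordinates centred at the blank. -/
def step (e : Dir d) : Equiv.Perm (Vtx d) := Equiv.swap 0 (vec e) * Equiv.addRight (vec e)

/-- The effect of a sequence of moves. -/
def word (w : List (Dir d)) : Equiv.Perm (Vtx d) := (w.map step).prod

/-- The displacement of the blank under a sequence of moves. -/
def disp (w : List (Dir d)) : Vtx d := (w.map vec).sum

@[simp] theorem word_nil : word ([] : List (Dir d)) = 1 := rfl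
@[simp] theorem disp_nil : disp ([] : List (Dir d)) = 0 := rfl
@[simp] theorem word_cons (e : Dir d) (w : List (Dir d)) : word (e :: w) = step e * word w := by
  simp [word]
@[simp] theorem disp_cons (e : Dir d) (w : List (Dir d)) : disp (e :: w) = vec e + disp w := by
  simp [disp]
theorem word_append (w w' : List (Dir d)) : word (w ++ w') = word w * word w' := by
  simp [word]
theorem disp_append (w w' : List (Dir d)) : disp (w ++ w') = disp w + disp w' := by
  simp [disp]

theorem vec_opp (e : Dir d) : vec (opp e) = -vec e := by
  rcases e with ⟨i, b⟩
  cases b <;> simp [vec, opp, ← Pi.single_neg]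

@[simp] theorem opp_opp (e : Dir d) : opp (opp e) = e := by simp [opp]

theorem vec_ne_zero (e : Dir d) : vec e ≠ 0 := by
  intro h
  have := congrFun h e.1
  rcases e with ⟨i, b⟩
  cases b <;> simp [vec] at this

theorem nrm_zero : nrm (0 : Vtx d) = 0 := by simp [nrm]

theorem nrm_eq_zero {v : Vtx d} : nrm v = 0 ↔ v = 0 := by
  simp [nrm, funext_iff]

theorem nrm_neg (v : Vtx d) : nrm (-v) = nrm v := by simp [nrm]

theorem nrm_add_le (v w : Vtx d) : nrm (v + w) ≤ nrm v + nrm w := by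
  rw [nrm, nrm, nrm, ← Finset.sum_add_distrib]
  exact Finset.sum_le_sum fun i _ => Int.natAbs_add_le _ _

theorem nrm_vec (e : Dir d) : nrm (vec e) = 1 := by
  rw [nrm, Finset.sum_eq_single e.1]
  · rcases e with ⟨i, b⟩
    cases b <;> simp [vec]
  · intro j _ hj
    simp [vec, hj]
  · simp

theorem nrm_le_nrm_add_vec (v : Vtx d) (e : Dir d) : nrm v ≤ nrm (v + vec e) + 1 := by
  have := nrm_add_le (v + vec e) (vec (opp e))
  rwa [vec_opp, add_neg_cancel_right, nrm_neg, nrm_vec] at this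

theorem nrm_disp_le (w : List (Dir d)) : nrm (disp w) ≤ w.length := by
  induction w with
  | nil => simp [nrm_zero]
  | cons e w ih =>
    have := nrm_add_le (vec e) (disp w)
    rw [nrm_vec] at this
    simp only [disp_cons, List.length_cons]
    omega

theorem exists_nrm_add_vec (v : Vtx d) (hv : v ≠ 0) : ∃ e : Dir d, nrm (v + vec e) + 1 = nrm v := by
  obtain ⟨i, hi⟩ := Function.ne_iff.1 hv
  simp only [Pi.zero_apply] at hi
  refine ⟨(i, decide (v i < 0)), ?_⟩
  rw [nrm, nrm, ← Finset.add_sum_erase _ _ (Finset.mem_univ i),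
    ← Finset.add_sum_erase _ _ (Finset.mem_univ i)]
  have h1 : ∑ j ∈ Finset.univ.erase i, ((v + vec (i, decide (v i < 0))) j).natAbs =
      ∑ j ∈ Finset.univ.erase i, (v j).natAbs := by
    refine Finset.sum_congr rfl fun j hj => ?_
    simp [vec, Finset.ne_of_mem_erase hj]
  rw [h1]
  have h2 : ((v + vec (i, decide (v i < 0))) i).natAbs + 1 = (v i).natAbs := by
    simp only [vec, Pi.add_apply, Pi.single_eq_same, decide_eq_true_eq]
    split_ifs <;> omega
  omega

theorem exists_vec_eq {v : Vtx d} (hv : nrm v = 1) : ∃ e : Dir d, v = vec e := by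
  obtain ⟨e, he⟩ := exists_nrm_add_vec v (by rintro rfl; simp [nrm_zero] at hv)
  rw [hv, Nat.succ_inj, nrm_eq_zero] at he
  exact ⟨opp e, by rw [vec_opp, eq_neg_of_add_eq_zero_left he]⟩

theorem step_apply (e : Dir d) (x : Vtx d) : step e x = Equiv.swap 0 (vec e) (x + vec e) := rfl

@[simp] theorem step_zero (e : Dir d) : step e 0 = 0 := by simp [step_apply]

theorem step_neg_vec (e : Dir d) : step e (-vec e) = vec e := by simp [step_apply]

theorem step_of_ne {e : Dir d} {x : Vtx d} (hx : x ≠ 0) (h : x + vec e ≠ 0) :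
    step e x = x + vec e := by
  rw [step_apply, Equiv.swap_apply_of_ne_of_ne h]
  simpa using hx

theorem step_opp_mul_step (e : Dir d) : step (opp e) * step e = 1 := by
  ext1 x
  rw [Equiv.Perm.mul_apply, Equiv.Perm.one_apply]
  by_cases hx : x = 0
  · simp [hx]
  by_cases h : x + vec e = 0
  · rw [eq_neg_of_add_eq_zero_left h, step_neg_vec]
    conv_lhs => rw [show vec e = -vec (opp e) by rw [vec_opp, neg_neg]]
    rw [step_neg_vec, vec_opp]
  · rw [step_of_ne hx h, step_of_ne h] <;> rw [vec_opp, add_neg_cancel_right]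
    exact hx

theorem step_inv (e : Dir d) : (step e)⁻¹ = step (opp e) :=
  inv_eq_of_mul_eq_one_left (step_opp_mul_step e)

@[simp] theorem word_zero (w : List (Dir d)) : word w 0 = 0 := by
  induction w with
  | nil => rfl
  | cons e w ih => rw [word_cons, Equiv.Perm.mul_apply, ih, step_zero]

/-- The reversed sequence of moves. -/
def rev (w : List (Dir d)) : List (Dir d) := (w.map opp).reverse

@[simp] theorem length_rev (w : List (Dir d)) : (rev w).length = w.length := by simp [rev]

theorem word_rev (w : List (Dir d)) : word (rev w) = (word w)⁻¹ := by
  induction w with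
  | nil => simp [rev]
  | cons e w ih =>
    have : rev (e :: w) = rev w ++ [opp e] := by simp [rev]
    rw [this, word_append, ih, word_cons, word_cons, word_nil, mul_one, mul_inv_rev, step_inv]

theorem disp_rev (w : List (Dir d)) : disp (rev w) = -disp w := by
  induction w with
  | nil => simp [rev]
  | cons e w ih =>
    have : rev (e :: w) = rev w ++ [opp e] := by simp [rev]
    rw [this, disp_append, ih, disp_cons, disp_cons, disp_nil, add_zero, vec_opp]
    abel

theorem word_apply_of_length_lt {w : List (Dir d)} {y : Vtx d} (h : w.length < nrm y) :
    word w (y - disp w) = y := by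
  induction w generalizing y with
  | nil => simp
  | cons e w ih =>
    have h1 := nrm_le_nrm_add_vec y (opp e)
    rw [vec_opp, ← sub_eq_add_neg] at h1
    simp only [List.length_cons] at h
    rw [word_cons, Equiv.Perm.mul_apply, disp_cons, ← sub_sub, ih (by omega), step_of_ne]
    · simp
    · intro h0
      rw [h0, nrm_zero] at h1
      omega
    · rw [sub_add_cancel]
      rintro rfl
      simp [nrm_zero] at h

theorem word_apply_of_length_lt_sub {w : List (Dir d)} {y : Vtx d}
    (h : w.length < nrm (y - disp w)) : word w (y - disp w) = y := by
  have := word_apply_of_length_lt (w := rev w) (y := y - disp w) (by simpa using h)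
  rw [disp_rev, sub_neg_eq_add, sub_add_cancel, word_rev, Equiv.Perm.inv_eq_iff_eq] at this
  exact this.symm

theorem exists_loop_moving (hd : 2 ≤ d) (m : ℕ) (y : Vtx d) (hy : y ≠ 0) (hm : nrm y ≤ m + 1) :
    ∃ w : List (Dir d), w.length = 4 + 2 * m ∧ disp w = 0 ∧ word w y ≠ y := by
  induction m generalizing y with
  | zero =>
    have h1 : nrm y = 1 := by
      have := mt nrm_eq_zero.1 hy
      omega
    obtain ⟨e, rfl⟩ := exists_vec_eq h1
    have : Nontrivial (Fin d) := Fin.nontrivial_iff_two_le.2 hd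
    obtain ⟨j, hj⟩ := exists_ne e.1
    set e' : Dir d := (j, true)
    have hne : vec e - vec e' ≠ 0 := by
      intro h
      have := congrFun h j
      simp [vec, e', hj] at this
    have hne2 : vec e' + vec e ≠ 0 := by
      intro h
      have := congrFun h j
      simp [vec, e', hj] at this
    refine ⟨[e, e', opp e, opp e'], rfl, by simp [vec_opp], ?_⟩
    simp only [word_cons, word_nil, mul_one, Equiv.Perm.mul_apply]
    have h1 : step (opp e') (vec e) = vec e - vec e' := by
      rw [step_of_ne hy] <;> rw [vec_opp, ← sub_eq_add_neg]
      exact hne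
    have h2 : step (opp e) (vec e - vec e') = -vec e' := by
      rw [step_of_ne hne] <;> rw [vec_opp]
      · abel
      · rw [show vec e - vec e' + -vec e = -vec e' by abel]
        exact neg_ne_zero.2 (vec_ne_zero _)
    rw [h1, h2, step_neg_vec, step_of_ne (vec_ne_zero _) hne2]
    simpa using vec_ne_zero e'
  | succ m ih =>
    by_cases h : nrm y ≤ m + 1
    · obtain ⟨w, hl, hw, hy'⟩ := ih y hy h
      have e : Dir d := (⟨0, by omega⟩, true)
      refine ⟨opp e :: e :: w, by simp [hl]; ring, by simp [hw, vec_opp], ?_⟩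
      rw [word_cons, word_cons, ← mul_assoc, step_opp_mul_step, one_mul]
      exact hy'
    · obtain ⟨e, he⟩ := exists_nrm_add_vec y hy
      have hne : y + vec e ≠ 0 := by
        intro h0
        rw [h0, nrm_zero] at he
        omega
      obtain ⟨w, hl, hw, hy'⟩ := ih (y + vec e) hne (by omega)
      refine ⟨opp e :: (w ++ [e]), by simp [hl]; ring, by simp [hw, disp_append, vec_opp], ?_⟩
      rw [word_cons, word_append, word_cons, word_nil, mul_one, Equiv.Perm.mul_apply,
        Equiv.Perm.mul_apply, step_of_ne hy hne, ← step_inv, Ne, Equiv.Perm.inv_eq_iff_eq,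
        step_of_ne hy hne]
      exact hy'

/-- The random walk measure of the puzzle. -/
noncomputable def walk (d : ℕ) : MonoidAlgebra ℝ (Equiv.Perm (Vtx d)) :=
  MonoidAlgebra.unif (step (d := d))

theorem walk_symm : (walk d).InvSymm :=
  MonoidAlgebra.InvSymm.unif _ ⟨opp, opp, opp_opp, opp_opp⟩ fun e => (step_inv e).symm

theorem walk_nonneg (g : Equiv.Perm (Vtx d)) : 0 ≤ (walk d).coeff g :=
  MonoidAlgebra.coeff_unif_nonneg _ _

theorem mass_walk (hd : 2 ≤ d) : MonoidAlgebra.mass (walk d) = 1 := by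
  have : Nonempty (Fin d) := ⟨⟨0, by omega⟩⟩
  exact MonoidAlgebra.mass_unif _

theorem coeff_walk_pow_succ (n : ℕ) (g : Equiv.Perm (Vtx d)) :
    (walk d ^ (n + 1)).coeff g = (2 * d : ℝ)⁻¹ * ∑ e, (walk d ^ n).coeff ((step e)⁻¹ * g) := by
  rw [pow_succ', walk, MonoidAlgebra.coeff_unif_mul]
  simp [mul_comm]

theorem coeff_one_apply (g : Equiv.Perm (Vtx d)) [Decidable (g = 1)] :
    (1 : MonoidAlgebra ℝ (Equiv.Perm (Vtx d))).coeff g = if g = 1 then 1 else 0 := by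
  classical
  simp only [MonoidAlgebra.one_def, MonoidAlgebra.coeff_single, Finsupp.single_apply]
  simp only [eq_comm]

/-- The number of paths from `x₀` for which `h` times the transposition product is `1`. -/
noncomputable def pathCount (n : ℕ) (x₀ : Vtx d) (h : Equiv.Perm (Vtx d)) : ℕ :=
  Nat.card {x : Fin (n + 1) → Vtx d // IsPath x ∧ x 0 = x₀ ∧ h * transProd x = 1}

theorem isPath_cons {n : ℕ} (x₀ : Vtx d) (x : Fin (n + 1) → Vtx d) :
    IsPath (Fin.cons x₀ x : Fin (n + 1 + 1) → Vtx d) ↔ dist1 (x 0) x₀ = 1 ∧ IsPath x := by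
  unfold IsPath
  rw [Fin.forall_fin_succ]
  simp

theorem transProd_cons {n : ℕ} (x₀ : Vtx d) (x : Fin (n + 1) → Vtx d) :
    transProd (Fin.cons x₀ x : Fin (n + 1 + 1) → Vtx d) =
      Equiv.swap x₀ (x 0) * transProd x := by
  unfold transProd
  rw [List.finRange_succ]
  simp [Function.comp_def]

theorem vec_injective : Function.Injective (vec (d := d)) := by
  rintro ⟨i, b⟩ ⟨j, c⟩ h
  have h1 := congrFun h i
  have h2 := congrFun h j
  by_cases hij : i = j
  · subst hij
    cases b <;> cases c <;> simp [vec] at h1 ⊢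
  · cases b <;> simp [vec, hij] at h1

theorem dist1_add_vec (x : Vtx d) (e : Dir d) : dist1 (x + vec e) x = 1 := by
  simpa [dist1, nrm] using nrm_vec e

theorem exists_eq_add_vec {x y : Vtx d} (h : dist1 y x = 1) : ∃ e, y = x + vec e := by
  obtain ⟨e, he⟩ := exists_vec_eq (v := y - x) (by simpa [dist1, nrm] using h)
  exact ⟨e, by rw [← he]; abel⟩

/-- Splitting off the first step of a path. -/
noncomputable def pathEquiv (n : ℕ) (x₀ : Vtx d) (h : Equiv.Perm (Vtx d)) :
    (Σ e : Dir d, {x : Fin (n + 1) → Vtx d // IsPath x ∧ x 0 = x₀ + vec e ∧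
      h * Equiv.swap x₀ (x₀ + vec e) * transProd x = 1}) ≃
    {x : Fin (n + 1 + 1) → Vtx d // IsPath x ∧ x 0 = x₀ ∧ h * transProd x = 1} := by
  refine Equiv.ofBijective (fun p => ⟨Fin.cons x₀ p.2.1, ?_, ?_, ?_⟩) ⟨?_, ?_⟩
  · rw [isPath_cons, p.2.2.2.1]
    exact ⟨dist1_add_vec _ _, p.2.2.1⟩
  · simp
  · rw [transProd_cons, p.2.2.2.1, ← mul_assoc]
    exact p.2.2.2.2
  · rintro ⟨e, x, hx⟩ ⟨e', x', hx'⟩ hh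
    simp only [Subtype.mk.injEq, Fin.cons_inj, true_and] at hh
    subst hh
    have : e = e' := vec_injective (add_left_cancel (hx.2.1.symm.trans hx'.2.1))
    subst this
    rfl
  · rintro ⟨x, hx⟩
    have hx0 := hx.2.1
    rw [← Fin.cons_self_tail x] at hx
    rw [isPath_cons, transProd_cons, hx0, ← mul_assoc] at hx
    obtain ⟨e, he⟩ := exists_eq_add_vec hx.1.1
    refine ⟨⟨e, Fin.tail x, hx.1.2, he, ?_⟩, ?_⟩
    · rw [← he]
      exact hx.2.2
    · simp only [Subtype.mk.injEq]
      conv_rhs => rw [← Fin.cons_self_tail x, hx0]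

theorem finite_paths (n : ℕ) (x₀ : Vtx d) (h : Equiv.Perm (Vtx d)) :
    Finite {x : Fin (n + 1) → Vtx d // IsPath x ∧ x 0 = x₀ ∧ h * transProd x = 1} := by
  induction n generalizing x₀ h with
  | zero =>
    refine @Finite.of_subsingleton _ ⟨fun x y => Subtype.ext (funext fun i => ?_)⟩
    rw [Fin.fin_one_eq_zero i, x.2.2.1, y.2.2.1]
  | succ n ih =>
    have := fun e : Dir d => ih (x₀ + vec e) (h * Equiv.swap x₀ (x₀ + vec e))
    exact Finite.of_equiv _ (pathEquiv n x₀ h)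

theorem pathCount_succ (n : ℕ) (x₀ : Vtx d) (h : Equiv.Perm (Vtx d)) :
    pathCount (n + 1) x₀ h =
      ∑ e, pathCount n (x₀ + vec e) (h * Equiv.swap x₀ (x₀ + vec e)) := by
  have := fun e : Dir d => finite_paths n (x₀ + vec e) (h * Equiv.swap x₀ (x₀ + vec e))
  rw [pathCount, ← Nat.card_congr (pathEquiv n x₀ h), Nat.card_sigma]
  rfl

theorem mul_swap_mul_addRight (h : Equiv.Perm (Vtx d)) (x : Vtx d) (e : Dir d) :
    h * Equiv.swap x (x + vec e) * Equiv.addRight (x + vec e) =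
      h * Equiv.addRight x * step e := by
  rw [mul_assoc, mul_assoc]
  congr 1
  ext1 z
  rw [step, Equiv.Perm.mul_apply, Equiv.Perm.mul_apply, Equiv.Perm.mul_apply]
  simp only [Equiv.coe_addRight]
  rw [Equiv.swap_apply_def, Equiv.swap_apply_def]
  have h1 : z + (x + vec e) = x ↔ z + vec e = 0 := by
    rw [show z + (x + vec e) = x + (z + vec e) by abel, add_eq_left]
  have h2 : z + (x + vec e) = x + vec e ↔ z + vec e = vec e := by simp
  rw [if_congr h1 rfl (if_congr h2 rfl rfl)]
  split_ifs <;> abel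

theorem pathCount_eq (hd : 2 ≤ d) (n : ℕ) (x₀ : Vtx d) (h : Equiv.Perm (Vtx d)) (hx : h x₀ = 0)
    (hfin : {z | h z ≠ z}.Finite) :
    (pathCount n x₀ h : ℝ) =
      (2 * d : ℝ) ^ n * (walk d ^ n).coeff (h * Equiv.addRight x₀)⁻¹ := by
  classical
  induction n generalizing x₀ h with
  | zero =>
    rw [pow_zero, pow_zero, one_mul, coeff_one_apply]
    have key : h = 1 ↔ (h * Equiv.addRight x₀)⁻¹ = 1 := by
      rw [inv_eq_one]
      constructor
      · rintro rfl
        obtain rfl : x₀ = 0 := hx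
        ext1 z
        simp
      · intro h1
        have h2 : ∀ z, h (z + x₀) = z := fun z => by
          simpa using congrArg (fun g : Equiv.Perm (Vtx d) => g z) h1
        have h3 : x₀ = 0 := by
          by_contra h0
          have : {z | h z ≠ z} = Set.univ := by
            refine Set.eq_univ_of_forall fun z => ?_
            have := h2 (z - x₀)
            rw [sub_add_cancel] at this
            rw [Set.mem_ofPred_eq, this]
            simpa using h0
          rw [this] at hfin
          have : Nonempty (Fin d) := ⟨⟨0, by omega⟩⟩
          exact Set.infinite_univ hfin
        ext1 z
        simpa [h3] using h2 z
    rw [pathCount]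
    split_ifs with h1
    · rw [← key] at h1
      subst h1
      have : Unique {x : Fin (0 + 1) → Vtx d // IsPath x ∧ x 0 = x₀ ∧ 1 * transProd x = 1} :=
        { default := ⟨fun _ => x₀, fun i => i.elim0, rfl, by simp [transProd]⟩
          uniq := fun y => Subtype.ext (funext fun i => by
            rw [Fin.fin_one_eq_zero i, y.2.2.1]) }
      rw [Nat.card_unique, Nat.cast_one]
    · rw [← key] at h1
      have : IsEmpty {x : Fin (0 + 1) → Vtx d // IsPath x ∧ x 0 = x₀ ∧ h * transProd x = 1} :=
        ⟨fun y => h1 (by simpa [transProd] using y.2.2.2)⟩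
      simp
  | succ n ih =>
    have hd0 : (2 * d : ℝ) ≠ 0 := by
      have : (d : ℝ) ≠ 0 := by exact_mod_cast (by omega : d ≠ 0)
      positivity
    rw [pathCount_succ, coeff_walk_pow_succ, pow_succ, mul_assoc, mul_inv_cancel_left₀ hd0,
      Finset.mul_sum, Nat.cast_sum]
    refine Finset.sum_congr rfl fun e _ => ?_
    rw [ih, mul_swap_mul_addRight, mul_inv_rev _ (step e)]
    · simp [hx]
    · refine (hfin.union (Set.toFinite {x₀, x₀ + vec e})).subset fun z hz => ?_
      by_contra hc
      simp only [Set.mem_union, Set.mem_ofPred_eq, Set.mem_insert_iff, Set.mem_singleton_iff,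
        not_or, not_not] at hc
      apply hz
      rw [Equiv.Perm.mul_apply, Equiv.swap_apply_of_ne_of_ne hc.2.1 hc.2.2, hc.1]

theorem T_div_eq (hd : 2 ≤ d) (n : ℕ) :
    (T n d : ℝ) / (2 * d) ^ n = (walk d ^ n).coeff 1 := by
  have h := pathCount_eq hd n 0 1 rfl (by simp)
  have hd0 : (2 * d : ℝ) ≠ 0 := by
    have : (d : ℝ) ≠ 0 := by exact_mod_cast (by omega : d ≠ 0)
    positivity
  have h2 : T n d = pathCount n (0 : Vtx d) 1 := by
    simp [T, numPathsIn, pathCount]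
  have h3 : (1 * Equiv.addRight (0 : Vtx d))⁻¹ = (1 : Equiv.Perm (Vtx d)) := by
    rw [inv_eq_one]
    ext1 z
    simp
  rw [h2, h, h3, mul_div_cancel_left₀ _ (pow_ne_zero n hd0)]

section Average

variable {ι : Type*} [Fintype ι]

/-- The average of `F` over the lists of length `n`. -/
noncomputable def avg : ℕ → (List ι → ℝ) → ℝ
  | 0, F => F []
  | n + 1, F => (Fintype.card ι : ℝ)⁻¹ * ∑ i, avg n fun l => F (i :: l)

theorem avg_sum {κ : Type*} (s : Finset κ) (n : ℕ) (F : κ → List ι → ℝ) :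
    avg n (fun l => ∑ k ∈ s, F k l) = ∑ k ∈ s, avg n (F k) := by
  induction n generalizing F with
  | zero => rfl
  | succ n ih =>
    simp only [avg, ih fun k l => F k (_ :: l), ← Finset.mul_sum]
    rw [Finset.sum_comm]

theorem avg_add (n : ℕ) (F F' : List ι → ℝ) :
    avg n (fun l => F l + F' l) = avg n F + avg n F' := by
  induction n generalizing F F' with
  | zero => rfl
  | succ n ih => simp only [avg, ih, Finset.sum_add_distrib, mul_add]

theorem avg_mul (n : ℕ) (c : ℝ) (F : List ι → ℝ) : avg n (fun l => c * F l) = c * avg n F := by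
  induction n generalizing F with
  | zero => rfl
  | succ n ih =>
    simp only [avg, ih, ← Finset.mul_sum]
    ring

theorem avg_mono (n : ℕ) {F F' : List ι → ℝ} (h : ∀ l, F l ≤ F' l) : avg n F ≤ avg n F' := by
  induction n generalizing F F' with
  | zero => exact h _
  | succ n ih =>
    exact mul_le_mul_of_nonneg_left (Finset.sum_le_sum fun i _ => ih fun l => h _) (by positivity)

theorem avg_const [Nonempty ι] (n : ℕ) (c : ℝ) : avg n (fun _ : List ι => c) = c := by
  induction n with
  | zero => rfl
  | succ n ih => simp [avg, ih]

theorem avg_append (m n : ℕ) (F : List ι → ℝ) :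
    avg (m + n) F = avg m fun l => avg n fun l' => F (l ++ l') := by
  induction m generalizing F with
  | zero => simp [avg]
  | succ m ih =>
    rw [Nat.succ_add, avg, avg]
    simp only [ih, List.cons_append]

theorem avg_comm (m n : ℕ) (F : List ι → List ι → ℝ) :
    (avg m fun l => avg n fun l' => F l l') = avg n fun l' => avg m fun l => F l l' := by
  induction m generalizing F with
  | zero => rfl
  | succ m ih => simp only [avg, ih, avg_mul, avg_sum]

end Average

section Weight

variable {X ι κ : Type*} [Fintype κ]

/-- The probability that a random product of the `σ k * u i`, for `i` running over a list and
`k` uniformly random, is `h⁻¹`. -/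
noncomputable def weight (σ : κ → Equiv.Perm X) (u : ι → Equiv.Perm X) :
    List ι → Equiv.Perm X → ℝ
  | [], h => by classical exact if h = 1 then 1 else 0
  | i :: l, h => (Fintype.card κ : ℝ)⁻¹ * ∑ k, weight σ u l (h * σ k * u i)

variable {σ : κ → Equiv.Perm X} {u : ι → Equiv.Perm X}

theorem coeff_unif_mul_unif_pow [Fintype ι] (n : ℕ) (h : Equiv.Perm X) :
    ((MonoidAlgebra.unif σ * MonoidAlgebra.unif u) ^ n).coeff h⁻¹ =
      avg n fun l => weight σ u l h := by
  classical
  induction n generalizing h with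
  | zero =>
    simp only [avg, weight, pow_zero, MonoidAlgebra.one_def, MonoidAlgebra.coeff_single,
      Finsupp.single_apply]
    simp only [eq_comm (a := (1 : Equiv.Perm X)), inv_eq_one]
  | succ n ih =>
    simp only [avg, weight, avg_mul, avg_sum, ← ih]
    rw [pow_succ', mul_assoc, MonoidAlgebra.coeff_unif_mul]
    simp only [MonoidAlgebra.coeff_unif_mul, ← Finset.mul_sum, mul_inv_rev, mul_assoc]
    rw [Finset.sum_comm]
    ring

end Weight

section Blocks

variable {X ι κ : Type*} [AddCommGroup X] [DecidableEq X]

/-- The total displacement of a list of blocks. -/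
def shift (δ : ι → X) (l : List ι) : X := (l.map δ).sum

/-- The sites that may be affected by a list of blocks. -/
def reach (N : Finset X) (δ : ι → X) : List ι → Finset X
  | [] => N
  | i :: l => N ∪ (reach N δ l).image (δ i + ·)

theorem subset_reach (N : Finset X) (δ : ι → X) (l : List ι) : N ⊆ reach N δ l := by
  cases l with
  | nil => exact subset_rfl
  | cons i l => exact Finset.subset_union_left

theorem mem_reach_cons {N : Finset X} {δ : ι → X} {i : ι} {l : List ι} {y : X} :
    y ∈ reach N δ (i :: l) ↔ y ∈ N ∨ y - δ i ∈ reach N δ l := by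
  simp only [reach, Finset.mem_union, Finset.mem_image]
  refine or_congr Iff.rfl ⟨?_, fun h => ⟨_, h, by abel⟩⟩
  rintro ⟨a, ha, rfl⟩
  simpa using ha

theorem image_range_subset_reach_append (N : Finset X) (δ : ι → X) (l l' : List ι) :
    (reach N δ l').image (shift δ l + ·) ⊆ reach N δ (l ++ l') := by
  induction l with
  | nil => simp [shift]
  | cons i l ih =>
    intro y hy
    rw [List.cons_append, mem_reach_cons]
    refine Or.inr (ih ?_)
    obtain ⟨a, ha, rfl⟩ := Finset.mem_image.1 hy
    refine Finset.mem_image.2 ⟨a, ha, ?_⟩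
    simp only [shift, List.map_cons, List.sum_cons]
    abel

theorem card_reach_le_append (N : Finset X) (δ : ι → X) (l l' : List ι) :
    (reach N δ l').card ≤ (reach N δ (l ++ l')).card := by
  rw [← Finset.card_image_of_injective _ (add_right_injective (shift δ l))]
  exact Finset.card_le_card (image_range_subset_reach_append N δ l l')

theorem card_reach_lt_append {N : Finset X} (hN : 0 ∈ N) (δ : ι → X) (l l' : List ι)
    (h : -shift δ l ∉ reach N δ l') :
    (reach N δ l').card + 1 ≤ (reach N δ (l ++ l')).card := by
  rw [← Finset.card_image_of_injective _ (add_right_injective (shift δ l))]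
  refine Finset.card_lt_card (Finset.ssubset_iff_of_subset
    (image_range_subset_reach_append N δ l l') |>.2 ⟨0, subset_reach _ _ _ hN, fun h0 => h ?_⟩)
  obtain ⟨a, ha, h1⟩ := Finset.mem_image.1 h0
  rwa [← eq_neg_of_add_eq_zero_right h1]

variable [Fintype κ] {σ : κ → Equiv.Perm X} {u : ι → Equiv.Perm X} {N : Finset X} {δ : ι → X}

theorem apply_of_weight_ne_zero (hu : ∀ i, ∀ z ∉ N, u i z = z + δ i)
    (hσ : ∀ k, ∀ z ∉ N, σ k z = z) (l : List ι) (h : Equiv.Perm X) (hw : weight σ u l h ≠ 0)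
    (y : X) (hy : y ∉ reach N δ l) : h y = y - shift δ l := by
  classical
  induction l generalizing h y with
  | nil =>
    obtain rfl : h = 1 := by
      by_contra hc
      exact hw (by simp [weight, hc])
    simp [shift]
  | cons i l ih =>
    obtain ⟨k, -, hk⟩ := Finset.exists_ne_zero_of_sum_ne_zero (right_ne_zero_of_mul hw)
    rw [mem_reach_cons, not_or] at hy
    have h1 := ih _ hk _ hy.2
    rw [Equiv.Perm.mul_apply, Equiv.Perm.mul_apply,
      hu i _ (fun hc => hy.2 (subset_reach _ _ _ hc)), sub_add_cancel, hσ k _ hy.1] at h1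
    rw [h1, shift, shift, List.map_cons, List.sum_cons]
    abel

theorem weight_mul_le [Nonempty κ] (hu : ∀ i, ∀ z ∉ N, u i z = z + δ i)
    (hσ : ∀ k, ∀ z ∉ N, σ k z = z) (hσ1 : ∃ k, σ k = 1)
    (hmove : ∀ y ∈ N, y ≠ 0 → ∃ k, σ k y ≠ y) (hδ : ∀ i, -δ i ∈ N)
    {θ : ℝ} (hθ0 : 0 ≤ θ) (hθ1 : θ ≤ 1) (hθ : 1 - (Fintype.card κ : ℝ)⁻¹ ≤ θ ^ N.card)
    (l : List ι) (h : Equiv.Perm X) :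
    weight σ u l h * θ ^ N.card ≤ θ ^ (reach N δ l).card := by
  classical
  have hc : (0 : ℝ) < Fintype.card κ := by exact_mod_cast Fintype.card_pos
  induction l generalizing h with
  | nil =>
    simp only [weight, reach]
    split_ifs
    · simp
    · rw [zero_mul]
      positivity
  | cons i l ih =>
    rw [weight, mul_assoc, Finset.sum_mul, inv_mul_le_iff₀ hc]
    by_cases hN : ∀ y ∈ N, y - δ i ∈ reach N δ l
    · have h1 : reach N δ (i :: l) = (reach N δ l).image (δ i + ·) := by
        rw [reach, Finset.union_eq_right]
        exact fun y hy => Finset.mem_image.2 ⟨_, hN y hy, by abel⟩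
      rw [h1, Finset.card_image_of_injective _ (add_right_injective _)]
      refine (Finset.sum_le_sum fun k _ => ih _).trans ?_
      simp
    · push Not at hN
      obtain ⟨y, hyN, hy⟩ := hN
      have hy0 : y ≠ 0 := by
        rintro rfl
        exact hy (subset_reach _ _ _ (by simpa using hδ i))
      obtain ⟨k₁, hk₁⟩ := hσ1
      obtain ⟨k₂, hk₂⟩ := hmove y hyN hy0
      have key : ∃ k, weight σ u l (h * σ k * u i) = 0 := by
        by_contra! hne
        have h2 : ∀ k, h (σ k y) = y - δ i - shift δ l := fun k => by
          have := apply_of_weight_ne_zero hu hσ l _ (hne k) _ hy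
          rwa [Equiv.Perm.mul_apply, Equiv.Perm.mul_apply,
            hu i _ (fun hc => hy (subset_reach _ _ _ hc)), sub_add_cancel] at this
        apply hk₂
        have := h.injective ((h2 k₂).trans (h2 k₁).symm)
        rwa [hk₁] at this
      obtain ⟨k, hk⟩ := key
      calc ∑ k, weight σ u l (h * σ k * u i) * θ ^ N.card
          = ∑ k ∈ Finset.univ.erase k, weight σ u l (h * σ k * u i) * θ ^ N.card := by
            rw [← Finset.add_sum_erase _ _ (Finset.mem_univ k), hk, zero_mul, zero_add]
        _ ≤ ∑ k ∈ Finset.univ.erase k, θ ^ (reach N δ l).card := Finset.sum_le_sum fun k _ => ih _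
        _ = (Fintype.card κ - 1) * θ ^ (reach N δ l).card := by
            rw [Finset.sum_const, Finset.card_erase_of_mem (Finset.mem_univ k), nsmul_eq_mul,
              Finset.card_univ, Nat.cast_pred Fintype.card_pos]
        _ = Fintype.card κ * ((1 - (Fintype.card κ : ℝ)⁻¹) * θ ^ (reach N δ l).card) := by
            field_simp
        _ ≤ Fintype.card κ * (θ ^ N.card * θ ^ (reach N δ l).card) := by gcongr
        _ ≤ Fintype.card κ * θ ^ (reach N δ (i :: l)).card := by
            rw [← pow_add]
            refine mul_le_mul_of_nonneg_left (pow_le_pow_of_le_one hθ0 hθ1 ?_) hc.le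
            exact (Finset.card_union_le _ _).trans (Nat.add_le_add_left Finset.card_image_le _)

end Blocks

section Growth

variable {X ι : Type*} [AddCommGroup X] [DecidableEq X] [Fintype ι] [Nonempty ι]
  {N : Finset X} {δ : ι → X} {φ : ℝ}

theorem avg_pow_reach_append_le (hN : 0 ∈ N) (hφ0 : 0 ≤ φ) (hφ1 : φ < 1) {T R : ℕ}
    (hq : ∀ x, avg T (fun l => if shift δ l = x then (1 : ℝ) else 0) ≤ (R : ℝ)⁻¹) (l' : List ι) :
    avg T (fun l => (φ ^ 2) ^ (reach N δ (l ++ l')).card) ≤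
      (1 + φ ^ 2) / 2 * (φ ^ 2) ^ (reach N δ l').card + φ ^ R := by
  have hθ1 : φ ^ 2 ≤ 1 := pow_le_one₀ hφ0 hφ1.le
  have hθ0 : 0 ≤ φ ^ 2 := by positivity
  rcases le_or_gt (2 * (reach N δ l').card) R with hR | hR
  · have h1 : ∀ l, (φ ^ 2) ^ (reach N δ (l ++ l')).card ≤
        (φ ^ 2) ^ (reach N δ l').card * φ ^ 2 + (φ ^ 2) ^ (reach N δ l').card * (1 - φ ^ 2) *
          ∑ y ∈ reach N δ l', if shift δ l = -y then (1 : ℝ) else 0 := by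
      intro l
      by_cases hl : -shift δ l ∈ reach N δ l'
      · have h2 : (1 : ℝ) ≤ ∑ y ∈ reach N δ l', if shift δ l = -y then (1 : ℝ) else 0 := by
          refine le_trans (by simp) (Finset.single_le_sum (f := fun y =>
            if shift δ l = -y then (1 : ℝ) else 0) (fun y _ => by split_ifs <;> norm_num) hl)
        have h3 := mul_le_mul_of_nonneg_left h2
          (mul_nonneg (pow_nonneg hθ0 (reach N δ l').card) (sub_nonneg.2 hθ1))
        have h4 := pow_le_pow_of_le_one hθ0 hθ1 (card_reach_le_append N δ l l')
        linarith
      · have h4 := pow_le_pow_of_le_one hθ0 hθ1 (card_reach_lt_append hN δ l l' hl)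
        rw [pow_succ] at h4
        refine h4.trans (le_add_of_nonneg_right ?_)
        exact mul_nonneg (mul_nonneg (by positivity) (sub_nonneg.2 hθ1))
          (Finset.sum_nonneg fun y _ => by split_ifs <;> norm_num)
    refine (avg_mono T h1).trans ?_
    rw [avg_add, avg_const, avg_mul, avg_sum]
    have h2 : ∑ y ∈ reach N δ l', avg T (fun l => if shift δ l = -y then (1 : ℝ) else 0) ≤
        1 / 2 := by
      refine (Finset.sum_le_sum fun y _ => hq (-y)).trans ?_
      rw [Finset.sum_const, nsmul_eq_mul]
      have hR' : (2 * (reach N δ l').card : ℝ) ≤ R := by exact_mod_cast hR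
      rcases Nat.eq_zero_or_pos R with rfl | hR0
      · norm_num
      · have : (0 : ℝ) < R := by exact_mod_cast hR0
        rw [← div_eq_mul_inv, div_le_iff₀ this]
        linarith
    have h3 := mul_le_mul_of_nonneg_left h2
      (mul_nonneg (pow_nonneg hθ0 (reach N δ l').card) (sub_nonneg.2 hθ1))
    have h4 : 0 ≤ φ ^ R := by positivity
    linarith
  · have h1 : ∀ l, (φ ^ 2) ^ (reach N δ (l ++ l')).card ≤ φ ^ R := by
      intro l
      rw [← pow_mul]
      refine pow_le_pow_of_le_one hφ0 hφ1.le (hR.le.trans ?_)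
      exact Nat.mul_le_mul_left 2 (card_reach_le_append N δ l l')
    refine (avg_mono T h1).trans ?_
    rw [avg_const]
    exact le_add_of_nonneg_left (by positivity)

theorem avg_pow_reach_le (hN : 0 ∈ N) (hφ0 : 0 ≤ φ) (hφ1 : φ < 1) {T R : ℕ}
    (hq : ∀ x, avg T (fun l => if shift δ l = x then (1 : ℝ) else 0) ≤ (R : ℝ)⁻¹) (m : ℕ) :
    avg (m * T) (fun l => (φ ^ 2) ^ (reach N δ l).card) ≤
      ((1 + φ ^ 2) / 2) ^ m + 2 / (1 - φ ^ 2) * φ ^ R := by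
  have hθ1 : φ ^ 2 < 1 := pow_lt_one₀ hφ0 hφ1 two_ne_zero
  have hθ0 : 0 ≤ φ ^ 2 := by positivity
  have hθ2 : 0 < 1 - φ ^ 2 := by linarith
  induction m with
  | zero =>
    rw [Nat.zero_mul, avg, pow_zero]
    have : (φ ^ 2) ^ (reach N δ []).card ≤ 1 := pow_le_one₀ hθ0 hθ1.le
    refine this.trans (le_add_of_nonneg_right (by positivity))
  | succ m ih =>
    rw [Nat.succ_mul, add_comm, avg_append, avg_comm]
    refine (avg_mono _ (avg_pow_reach_append_le hN hφ0 hφ1 hq)).trans ?_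
    rw [avg_add, avg_const, avg_mul]
    have h1 := mul_le_mul_of_nonneg_left ih (by positivity : 0 ≤ (1 + φ ^ 2) / 2)
    refine (add_le_add_left h1 _).trans (le_of_eq ?_)
    field_simp
    ring

theorem avg_pow_reach_le_of_le (hN : 0 ∈ N) (hφ0 : 0 ≤ φ) (hφ1 : φ < 1) {T R : ℕ}
    (hq : ∀ x, avg T (fun l => if shift δ l = x then (1 : ℝ) else 0) ≤ (R : ℝ)⁻¹) {m n : ℕ}
    (hmn : m * T ≤ n) :
    avg n (fun l => (φ ^ 2) ^ (reach N δ l).card) ≤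
      ((1 + φ ^ 2) / 2) ^ m + 2 / (1 - φ ^ 2) * φ ^ R := by
  refine le_trans ?_ (avg_pow_reach_le hN hφ0 hφ1 hq m)
  obtain ⟨a, rfl⟩ := Nat.exists_eq_add_of_le' hmn
  rw [avg_append, avg_comm]
  refine avg_mono _ fun l' => ?_
  have h1 : ∀ l : List ι, (φ ^ 2) ^ (reach N δ (l ++ l')).card ≤ (φ ^ 2) ^ (reach N δ l').card :=
    fun l => pow_le_pow_of_le_one (by positivity) (pow_le_one₀ hφ0 hφ1.le)
      (card_reach_le_append N δ l l')
  exact (avg_mono a h1).trans_eq (avg_const _ _)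

end Growth

section Lazy

/-- The displacement of one lazy step on `ℤ`. -/
def lazyStep (e : Bool × Bool) : ℤ := e.1.toNat - e.2.toNat

/-- The binomial coefficient, extended by zero to negative lower arguments. -/
def chooseInt (n : ℕ) (j : ℤ) : ℕ := if 0 ≤ j then n.choose j.toNat else 0

theorem chooseInt_succ (n : ℕ) (j : ℤ) :
    chooseInt (n + 1) j = chooseInt n (j - 1) + chooseInt n j := by
  unfold chooseInt
  rcases lt_trichotomy j 0 with h | rfl | h
  · rw [if_neg (by omega), if_neg (by omega), if_neg (by omega)]
  · simp
  · obtain ⟨k, rfl⟩ : ∃ k : ℕ, j = k + 1 := ⟨(j - 1).toNat, by omega⟩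
    rw [if_pos (by omega), if_pos (by omega), if_pos (by omega), add_sub_cancel_right]
    exact Nat.choose_succ_succ n k

theorem chooseInt_le (n : ℕ) (j : ℤ) : chooseInt (2 * n) j ≤ n.centralBinom := by
  unfold chooseInt
  split_ifs
  · exact Nat.choose_le_centralBinom _ _
  · exact Nat.zero_le _

theorem centralBinom_sq_mul_le (n : ℕ) : n.centralBinom ^ 2 * (2 * n + 1) ≤ 16 ^ n := by
  induction n with
  | zero => simp
  | succ n ih =>
    have h := Nat.succ_mul_centralBinom_succ n
    have h1 : (n + 1) ^ 2 * ((n + 1).centralBinom ^ 2 * (2 * (n + 1) + 1)) ≤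
        (n + 1) ^ 2 * 16 ^ (n + 1) := by
      calc (n + 1) ^ 2 * ((n + 1).centralBinom ^ 2 * (2 * (n + 1) + 1))
          = ((n + 1) * (n + 1).centralBinom) ^ 2 * (2 * n + 3) := by ring
        _ = n.centralBinom ^ 2 * (2 * n + 1) * (4 * (2 * n + 1) * (2 * n + 3)) := by
          rw [h]
          ring
        _ ≤ 16 ^ n * (4 * (2 * n + 1) * (2 * n + 3)) := Nat.mul_le_mul_right _ ih
        _ ≤ 16 ^ n * (16 * (n + 1) ^ 2) := Nat.mul_le_mul_left _ (by ring_nf; omega)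
        _ = (n + 1) ^ 2 * 16 ^ (n + 1) := by ring
    exact Nat.le_of_mul_le_mul_left h1 (by positivity)

theorem centralBinom_sq_le {r : ℕ} (hr : 0 < r) :
    ((r ^ 2).centralBinom : ℝ) / 4 ^ r ^ 2 ≤ (r : ℝ)⁻¹ := by
  have h := centralBinom_sq_mul_le (r ^ 2)
  have h2 : (((r ^ 2).centralBinom : ℝ) * r) ^ 2 ≤ (4 ^ r ^ 2) ^ 2 := by
    rw [← pow_mul, mul_comm _ 2, pow_mul]
    norm_num
    have h3 : (r ^ 2).centralBinom ^ 2 * r ^ 2 ≤ 16 ^ r ^ 2 := by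
      refine le_trans (Nat.mul_le_mul_left _ (by omega)) h
    rw [mul_pow]
    exact_mod_cast h3
  have h3 := le_of_sq_le_sq h2 (by positivity)
  have hr' : (0 : ℝ) < r := by exact_mod_cast hr
  rw [div_le_iff₀ (by positivity), inv_mul_eq_div, le_div_iff₀ hr']
  exact h3

/-- The displacement of one step of the walk on `ℤ^d` with independent lazy coordinates. -/
def lazyVec (e : Fin d → Bool × Bool) : Vtx d := fun i => lazyStep (e i)

theorem avg_shift_lazyVec (n : ℕ) (x : Vtx d) :
    avg n (fun l => if shift lazyVec l = x then (1 : ℝ) else 0) =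
      ∏ i, (chooseInt (2 * n) (x i + n) : ℝ) / 4 ^ n := by
  induction n generalizing x with
  | zero =>
    have h : ∀ i, (chooseInt (2 * 0) (x i + (0 : ℕ)) : ℝ) / 4 ^ 0 = if x i = 0 then 1 else 0 := by
      intro i
      unfold chooseInt
      rcases lt_trichotomy (x i) 0 with h | h | h
      · simp [h.not_ge, h.ne]
      · simp [h]
      · obtain ⟨k, hk⟩ : ∃ k : ℕ, x i = k + 1 := ⟨(x i - 1).toNat, by omega⟩
        have h4 : ((k : ℤ) + 1).toNat = k + 1 := by omega
        simp [hk, h4]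
        omega
    simp only [avg, h]
    by_cases hx : ∀ i, x i = 0
    · rw [Finset.prod_eq_one fun i _ => if_pos (hx i), if_pos]
      ext i
      simp [shift, hx i]
    · rw [if_neg]
      · push Not at hx
        obtain ⟨i, hi⟩ := hx
        rw [Finset.prod_eq_zero (Finset.mem_univ i) (if_neg hi)]
      · rintro rfl
        exact hx fun i => rfl
  | succ n ih =>
    have h1 : ∀ (e : Fin d → Bool × Bool) l, shift lazyVec (e :: l) = x ↔
        shift lazyVec l = x - lazyVec e := fun e l => by
      rw [shift, List.map_cons, List.sum_cons, eq_sub_iff_add_eq, add_comm]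
      rfl
    have h2 : ∀ y : ℤ, (chooseInt (2 * (n + 1)) (y + (n + 1 : ℕ)) : ℝ) / 4 ^ (n + 1) =
        4⁻¹ * ∑ e : Bool × Bool, (chooseInt (2 * n) (y - lazyStep e + n) : ℝ) / 4 ^ n := by
      intro y
      rw [show 2 * (n + 1) = 2 * n + 1 + 1 by ring, chooseInt_succ, chooseInt_succ,
        chooseInt_succ, Fintype.sum_prod_type]
      simp only [Fintype.sum_bool, lazyStep, Bool.toNat_true, Bool.toNat_false]
      rw [show y + ((n + 1 : ℕ) : ℤ) - 1 - 1 = y - 1 + n by push_cast; ring,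
        show y + ((n + 1 : ℕ) : ℤ) - 1 = y + n by push_cast; ring]
      push_cast
      rw [sub_zero, show y - -1 + (n : ℤ) = y + (n + 1) by ring]
      field_simp
      ring
    simp only [avg, h1, ih, h2]
    rw [Finset.prod_mul_distrib, Finset.prod_univ_sum, Fintype.piFinset_univ]
    simp [lazyVec]

theorem avg_shift_lazyVec_le {r : ℕ} (hr : 0 < r) (x : Vtx d) :
    avg (r ^ 2) (fun l => if shift lazyVec l = x then (1 : ℝ) else 0) ≤ ((r ^ d : ℕ) : ℝ)⁻¹ := by
  rw [avg_shift_lazyVec]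
  calc _ ≤ ∏ i : Fin d, (r : ℝ)⁻¹ := by
        refine Finset.prod_le_prod (fun i _ => by positivity) fun i _ => ?_
        refine le_trans ?_ (centralBinom_sq_le hr)
        gcongr
        exact chooseInt_le _ _
    _ = _ := by simp

end Lazy

/-- The permutations produced by closed loops of length `4 * d + 4`. -/
def loops (d : ℕ) : Set (Equiv.Perm (Vtx d)) :=
  {g | ∃ w : List (Dir d), w.length = 4 * d + 4 ∧ disp w = 0 ∧ word w = g}

theorem finite_loops (d : ℕ) : (loops d).Finite := by
  refine ((List.finite_length_eq (Dir d) (4 * d + 4)).image word).subset ?_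
  rintro g ⟨w, hw, -, rfl⟩
  exact ⟨w, hw, rfl⟩

noncomputable instance : Fintype (loops d) := (finite_loops d).fintype

theorem one_mem_loops (hd : 2 ≤ d) : 1 ∈ loops d := by
  have e : Dir d := (⟨0, by omega⟩, true)
  refine ⟨List.replicate (2 * d + 2) e ++ rev (List.replicate (2 * d + 2) e), ?_, ?_, ?_⟩
  · simp
    ring
  · rw [disp_append, disp_rev, add_neg_cancel]
  · rw [word_append, word_rev, mul_inv_cancel]

theorem inv_mem_loops {g : Equiv.Perm (Vtx d)} (hg : g ∈ loops d) : g⁻¹ ∈ loops d := by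
  obtain ⟨w, hw, h0, rfl⟩ := hg
  exact ⟨rev w, by rw [length_rev, hw], by rw [disp_rev, h0, neg_zero], word_rev w⟩

theorem finite_nrm_le (d m : ℕ) : {y : Vtx d | nrm y ≤ m}.Finite := by
  refine (Set.finite_Icc (fun _ : Fin d => -(m : ℤ)) fun _ => m).subset fun y hy => ?_
  have h : ∀ i, (y i).natAbs ≤ m := fun i =>
    (Finset.single_le_sum (f := fun i => (y i).natAbs) (fun _ _ => Nat.zero_le _)
      (Finset.mem_univ i)).trans hy
  exact ⟨fun i => by have := h i; simp only; omega, fun i => by have := h i; simp only; omega⟩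

theorem finite_moved (d : ℕ) : {y : Vtx d | y = 0 ∨ ∃ g ∈ loops d, g y ≠ y}.Finite := by
  refine (finite_nrm_le d (4 * d + 4)).subset fun y hy => ?_
  rcases hy with rfl | ⟨g, ⟨w, hw, h0, rfl⟩, hg⟩
  · simp [nrm_zero]
  · by_contra hc
    have := word_apply_of_length_lt (w := w) (y := y) (by rw [hw]; exact not_le.1 hc)
    rw [h0, sub_zero] at this
    exact hg this

/-- The sites moved by some short loop, together with the origin. -/
noncomputable def moved (d : ℕ) : Finset (Vtx d) := (finite_moved d).toFinset

theorem mem_moved {y : Vtx d} : y ∈ moved d ↔ y = 0 ∨ ∃ g ∈ loops d, g y ≠ y := by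
  simp [moved]

theorem mem_moved_of_nrm_le (hd : 2 ≤ d) {y : Vtx d} (hy : nrm y ≤ 2 * d) : y ∈ moved d := by
  rw [mem_moved]
  by_cases h0 : y = 0
  · exact Or.inl h0
  · obtain ⟨w, hw, hw0, hw1⟩ := exists_loop_moving hd (2 * d) y h0 (by omega)
    exact Or.inr ⟨_, ⟨w, by omega, hw0, rfl⟩, hw1⟩

/-- The moves along a diagonal direction. -/
def diag (ε : Fin d → Bool) : List (Dir d) := (List.finRange d).map fun i => (i, ε i)

@[simp] theorem length_diag (ε : Fin d → Bool) : (diag ε).length = d := by simp [diag]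

theorem disp_diag (ε : Fin d → Bool) (i : Fin d) : disp (diag ε) i = 2 * (ε i).toNat - 1 := by
  have h : disp (diag ε) = ∑ j, vec (j, ε j) := by
    rw [disp, diag, List.map_map, ← Fin.sum_univ_def]
    rfl
  rw [h, Finset.sum_apply, Finset.sum_eq_single i]
  · cases h : ε i <;> simp [vec]
  · intro j _ hj
    simp [vec, hj.symm]
  · simp

/-- The moves of a diagonal walk followed by another one. -/
def turn (e : Fin d → Bool × Bool) : List (Dir d) :=
  rev (diag fun i => (e i).2) ++ diag fun i => (e i).1

theorem disp_turn (e : Fin d → Bool × Bool) : disp (turn e) = 2 • lazyVec e := by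
  ext i
  rw [turn, disp_append, disp_rev, Pi.add_apply, Pi.neg_apply, disp_diag, disp_diag]
  simp only [Pi.smul_apply, lazyVec, lazyStep, nsmul_eq_mul]
  push_cast
  ring

theorem length_turn (e : Fin d → Bool × Bool) : (turn e).length = 2 * d := by
  simp [turn]
  ring

theorem avg_shift_turn_le {r : ℕ} (hr : 0 < r) (x : Vtx d) :
    avg (r ^ 2) (fun l => if shift (fun e => disp (turn e)) l = x then (1 : ℝ) else 0) ≤
      ((r ^ d : ℕ) : ℝ)⁻¹ := by
  refine le_trans (avg_mono _ fun l => ?_) (avg_shift_lazyVec_le hr fun i => x i / 2)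
  have h : shift (fun e : Fin d → Bool × Bool => disp (turn e)) l = 2 • shift lazyVec l := by
    simp only [shift, disp_turn, List.smul_sum, List.map_map, Function.comp_def]
  rw [h]
  split_ifs with h1 h2
  · exact le_rfl
  · refine absurd ?_ h2
    rw [← h1]
    ext i
    simp
  · exact zero_le_one
  · exact le_rfl

theorem avg_weight_le (hd : 2 ≤ d) : ∃ C ≥ (1 : ℝ), ∃ φ > (0 : ℝ), φ < 1 ∧
    ∀ r > 0, ∀ n, r ^ (d + 2) ≤ n →
      avg n (fun l => weight (Subtype.val : loops d → _) (fun e => word (turn e)) l 1) ≤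
        C * φ ^ r ^ d := by
  classical
  have : Nonempty (loops d) := ⟨⟨1, one_mem_loops hd⟩⟩
  set N := moved d with hN
  set k := Fintype.card (loops d) with hk
  have hN0 : (0 : Vtx d) ∈ N := mem_moved.2 (Or.inl rfl)
  have hNc : (1 : ℝ) ≤ N.card := by exact_mod_cast Finset.card_pos.2 ⟨0, hN0⟩
  have hkc : (1 : ℝ) ≤ k := by exact_mod_cast Fintype.card_pos
  set φ : ℝ := 1 + -(2 * N.card * k : ℝ)⁻¹ with hφ
  have h1 : (2 * N.card * k : ℝ)⁻¹ ≤ 1 / 2 := by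
    rw [inv_le_comm₀ (by positivity) (by norm_num)]
    nlinarith
  have h2 : 0 < (2 * N.card * k : ℝ)⁻¹ := by positivity
  have hφ0 : 0 < φ := by linarith
  have hφ1 : φ < 1 := by linarith
  have hθ0 : 0 < φ ^ 2 := by positivity
  have hθ1 : φ ^ 2 < 1 := pow_lt_one₀ hφ0.le hφ1 two_ne_zero
  have hθ2 : 0 < 1 - φ ^ 2 := by linarith
  have hθ : 1 - (k : ℝ)⁻¹ ≤ (φ ^ 2) ^ N.card := by
    have h3 := one_add_mul_le_pow (a := -(2 * N.card * k : ℝ)⁻¹) (by linarith) (2 * N.card)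
    rw [← pow_mul]
    refine le_trans (le_of_eq ?_) h3
    push_cast
    field_simp
    ring
  have hρ : φ ^ 2 ≤ (1 + φ ^ 2) / 2 := by linarith
  have hwt : ∀ l, weight (Subtype.val : loops d → _) (fun e => word (turn e)) l 1 ≤
      ((φ ^ 2) ^ N.card)⁻¹ * (φ ^ 2) ^ (reach N (fun e => disp (turn e)) l).card := by
    intro l
    rw [inv_mul_eq_div, le_div_iff₀ (by positivity)]
    refine weight_mul_le (fun e z hz => ?_) (fun g z hz => ?_) ⟨⟨1, one_mem_loops hd⟩, rfl⟩
      (fun y hy hy0 => ?_) (fun e => ?_) hθ0.le hθ1.le hθ l 1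
    · have h4 := word_apply_of_length_lt_sub (w := turn e) (y := z + disp (turn e)) (by
        rw [add_sub_cancel_right, length_turn]
        by_contra hc
        exact hz (mem_moved_of_nrm_le hd (not_lt.1 hc)))
      rwa [add_sub_cancel_right] at h4
    · by_contra hc
      exact hz (mem_moved.2 (Or.inr ⟨g, g.2, hc⟩))
    · obtain ⟨g, hg, hgy⟩ := (mem_moved.1 hy).resolve_left hy0
      exact ⟨⟨g, hg⟩, hgy⟩
    · refine mem_moved_of_nrm_le hd ?_
      rw [nrm_neg]
      exact (nrm_disp_le _).trans (length_turn e).le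
  refine ⟨((φ ^ 2) ^ N.card)⁻¹ * (1 + 2 / (1 - φ ^ 2)), ?_, max φ ((1 + φ ^ 2) / 2),
    lt_max_of_lt_left hφ0, max_lt hφ1 (by linarith), fun r hr n hn => ?_⟩
  · have h4 : 1 ≤ ((φ ^ 2) ^ N.card)⁻¹ :=
      (one_le_inv₀ (by positivity)).2 (pow_le_one₀ hθ0.le hθ1.le)
    have h5 : 0 ≤ 2 / (1 - φ ^ 2) := by positivity
    nlinarith
  · refine (avg_mono n hwt).trans ?_
    rw [avg_mul, mul_assoc]
    refine mul_le_mul_of_nonneg_left ?_ (by positivity)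
    refine (avg_pow_reach_le_of_le hN0 hφ0.le hφ1 (T := r ^ 2) (R := r ^ d) (m := r ^ d)
      (avg_shift_turn_le hr) (by rw [← pow_add]; exact hn)).trans ?_
    rw [add_mul, one_mul]
    have h6 : (0 : ℝ) < 2 / (1 - φ ^ 2) := by positivity
    gcongr
    · exact le_max_right _ _
    · exact le_max_left _ _

/-- A symmetric step distribution that randomises the pieces around each visited site. -/
noncomputable def blockWalk (d : ℕ) : MonoidAlgebra ℝ (Equiv.Perm (Vtx d)) :=
  MonoidAlgebra.unif fun p : (Fin d → Bool) × loops d × (Fin d → Bool) =>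
    word (diag p.1) * (p.2.1 * (word (diag p.2.2))⁻¹)

theorem blockWalk_symm : (blockWalk d).InvSymm := by
  refine MonoidAlgebra.InvSymm.unif _
    (Function.Involutive.toPerm (fun p => (p.2.2, ⟨_, inv_mem_loops p.2.1.2⟩, p.1)) fun p => ?_)
    fun p => ?_
  · simp
  · change word (diag p.2.2) * ((p.2.1 : Equiv.Perm (Vtx d))⁻¹ * (word (diag p.1))⁻¹) = _
    simp [mul_assoc]

theorem mass_blockWalk (hd : 2 ≤ d) : MonoidAlgebra.mass (blockWalk d) = 1 := by
  have : Nonempty (loops d) := ⟨⟨1, one_mem_loops hd⟩⟩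
  exact MonoidAlgebra.mass_unif _

theorem smul_blockWalk_le (g : Equiv.Perm (Vtx d)) :
    ((2 * d : ℝ)⁻¹) ^ (6 * d + 4) * (blockWalk d).coeff g ≤ (walk d ^ (6 * d + 4)).coeff g := by
  have h : (2 * d : ℝ) = Fintype.card (Dir d) := by simp [mul_comm]
  rw [h]
  refine MonoidAlgebra.coeff_unif_le_unif_pow _ _ _ (fun p => ?_) g
  obtain ⟨w, hw, -, hg⟩ := p.2.1.2
  refine ⟨diag p.1 ++ (w ++ rev (diag p.2.2)), ?_, ?_⟩
  · simp only [List.length_append, length_diag, length_rev, hw]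
    ring
  · change word _ = _
    rw [word_append, word_append, word_rev, hg]

theorem coeff_blockWalk_pow (n : ℕ) : (blockWalk d ^ n).coeff 1 =
    avg n fun l => weight (Subtype.val : loops d → _) (fun e => word (turn e)) l 1 := by
  have h1 : blockWalk d = MonoidAlgebra.unif (fun ε : Fin d → Bool => word (diag ε)) *
      (MonoidAlgebra.unif (Subtype.val : loops d → _) *
        MonoidAlgebra.unif fun ε : Fin d → Bool => (word (diag ε))⁻¹) := by
    rw [MonoidAlgebra.unif_mul_unif, MonoidAlgebra.unif_mul_unif]
    rfl
  have h2 : MonoidAlgebra.unif (fun e : Fin d → Bool × Bool => word (turn e)) =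
      MonoidAlgebra.unif (fun ε : Fin d → Bool => (word (diag ε))⁻¹) *
        MonoidAlgebra.unif (fun ε : Fin d → Bool => word (diag ε)) := by
    rw [MonoidAlgebra.unif_mul_unif, ← MonoidAlgebra.unif_comp_equiv _
      ((Equiv.arrowProdEquivProdArrow (Fin d) (fun _ => Bool) fun _ => Bool).trans
        (Equiv.prodComm _ _))]
    congr 1
    ext1 e
    rw [turn, word_append, word_rev]
    rfl
  rw [h1, MonoidAlgebra.coeff_mul_pow_one_comm, mul_assoc, ← h2, ← coeff_unif_mul_unif_pow, inv_one]

theorem coeff_blockWalk_pow_le (hd : 2 ≤ d) : ∃ C ≥ (1 : ℝ), ∃ a > (0 : ℝ), ∀ n : ℕ,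
    (blockWalk d ^ n).coeff 1 ≤ C * Real.exp (-(a * (n : ℝ) ^ ((d : ℝ) / (d + 2)))) := by
  classical
  obtain ⟨C, hC, φ, hφ0, hφ1, h⟩ := avg_weight_le hd
  have ha : 0 < -Real.log φ := neg_pos.2 (Real.log_neg hφ0 hφ1)
  refine ⟨C, hC, -Real.log φ / 2 ^ d, by positivity, fun n => ?_⟩
  have hd0 : (0 : ℝ) < d := by exact_mod_cast (by omega : 0 < d)
  rcases Nat.eq_zero_or_pos n with rfl | hn
  · rw [pow_zero, Nat.cast_zero, Real.zero_rpow (by positivity), mul_zero, neg_zero, Real.exp_zero,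
      mul_one, coeff_one_apply, if_pos rfl]
    exact hC
  · have hn1 : (1 : ℝ) ≤ n := by exact_mod_cast hn
    set s : ℝ := (n : ℝ) ^ ((1 : ℝ) / (d + 2)) with hs
    have hs1 : 1 ≤ s := Real.one_le_rpow hn1 (by positivity)
    have hr0 : 0 < ⌊s⌋₊ := Nat.floor_pos.2 hs1
    have hrs : (⌊s⌋₊ : ℝ) ≤ s := Nat.floor_le (by positivity)
    have hsr : s ≤ 2 * ⌊s⌋₊ := by
      have h1 := Nat.lt_floor_add_one s
      have h2 : (1 : ℝ) ≤ ⌊s⌋₊ := by exact_mod_cast hr0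
      linarith
    have hsn : s ^ (d + 2) = n := by
      rw [hs, ← Real.rpow_natCast, ← Real.rpow_mul (by positivity)]
      push_cast
      rw [one_div_mul_cancel (by positivity), Real.rpow_one]
    have hsd : s ^ d = (n : ℝ) ^ ((d : ℝ) / (d + 2)) := by
      rw [hs, ← Real.rpow_natCast, ← Real.rpow_mul (by positivity)]
      congr 1
      ring
    have hrn : ⌊s⌋₊ ^ (d + 2) ≤ n := by
      have : (⌊s⌋₊ : ℝ) ^ (d + 2) ≤ n := by
        rw [← hsn]
        gcongr
      exact_mod_cast this
    rw [coeff_blockWalk_pow]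
    refine (h _ hr0 n hrn).trans ?_
    refine mul_le_mul_of_nonneg_left ?_ (by positivity)
    rw [← hsd]
    nth_rw 1 [← Real.exp_log hφ0]
    rw [← Real.exp_nat_mul, Real.exp_le_exp]
    have h3 : s ^ d ≤ 2 ^ d * (⌊s⌋₊ : ℝ) ^ d := by
      rw [← mul_pow]
      gcongr
    push_cast
    have h4 := mul_le_mul_of_nonneg_left h3 ha.le
    have h5 : -Real.log φ / 2 ^ d * s ^ d ≤ -Real.log φ * (⌊s⌋₊ : ℝ) ^ d := by
      rw [div_mul_eq_mul_div, div_le_iff₀ (by positivity)]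
      linarith
    linarith

theorem mul_rpow_sub_one_le {α : ℝ} (hα0 : 0 < α) (hα1 : α ≤ 1) {n m : ℕ} (h : n ≤ m) :
    (n : ℝ) * (m : ℝ) ^ (α - 1) ≤ (n : ℝ) ^ α := by
  rcases Nat.eq_zero_or_pos n with rfl | hn
  · simp [hα0.ne']
  · have hn0 : (0 : ℝ) < n := by exact_mod_cast hn
    calc (n : ℝ) * (m : ℝ) ^ (α - 1) ≤ n * (n : ℝ) ^ (α - 1) :=
          mul_le_mul_of_nonneg_left (Real.rpow_le_rpow_of_nonpos hn0 (by exact_mod_cast h)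
            (by linarith)) hn0.le
      _ = (n : ℝ) ^ α := by
          rw [Real.rpow_sub_one hn0.ne', mul_div_cancel₀ _ hn0.ne']

theorem binomial_exp_rpow_le {C a c α : ℝ} (hC : 0 ≤ C) (ha : 0 < a) (hc0 : 0 < c) (hc1 : c ≤ 1)
    (hα0 : 0 < α) (hα1 : α ≤ 1) {b : ℕ → ℝ}
    (hb : ∀ n : ℕ, b n ≤ C * Real.exp (-(a * (n : ℝ) ^ α))) {m : ℕ} (hm : 0 < m) :
    ∑ n ∈ Finset.range (m + 1), c ^ n * (1 - c) ^ (m - n) * m.choose n * b n ≤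
      C * Real.exp (-(c * (a / (1 + a)) * (m : ℝ) ^ α)) := by
  have hm1 : (1 : ℝ) ≤ m := by exact_mod_cast hm
  have hm0 : (0 : ℝ) < m := by linarith
  set t : ℝ := (m : ℝ) ^ (α - 1) with ht
  have ht0 : 0 < t := by positivity
  have ht1 : t ≤ 1 := Real.rpow_le_one_of_one_le_of_nonpos hm1 (by linarith)
  have hmt : m * t = (m : ℝ) ^ α := by
    rw [ht, Real.rpow_sub_one hm0.ne', mul_div_cancel₀ _ hm0.ne']
  have h1c : 0 ≤ 1 - c := by linarith
  calc ∑ n ∈ Finset.range (m + 1), c ^ n * (1 - c) ^ (m - n) * m.choose n * b n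
      ≤ ∑ n ∈ Finset.range (m + 1),
          C * ((c * Real.exp (-(a * t))) ^ n * (1 - c) ^ (m - n) * m.choose n) := by
        refine Finset.sum_le_sum fun n hn => ?_
        have h1 : b n ≤ C * Real.exp (-(a * t)) ^ n := by
          refine (hb n).trans (mul_le_mul_of_nonneg_left ?_ hC)
          rw [← Real.exp_nat_mul, Real.exp_le_exp]
          have := mul_le_mul_of_nonneg_left
            (mul_rpow_sub_one_le hα0 hα1 (Nat.lt_succ_iff.1 (Finset.mem_range.1 hn))) ha.le
          linarith
        refine (mul_le_mul_of_nonneg_left h1 (by positivity)).trans (le_of_eq ?_)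
        rw [mul_pow]
        ring
    _ = C * (c * Real.exp (-(a * t)) + (1 - c)) ^ m := by rw [← Finset.mul_sum, add_pow]
    _ ≤ C * Real.exp (-(c * (a / (1 + a)) * t)) ^ m := by
        gcongr
        have h1 : Real.exp (-(a * t)) ≤ 1 - a / (1 + a) * t := by
          rw [Real.exp_neg, inv_le_comm₀ (Real.exp_pos _)]
          · refine le_trans ?_ (Real.add_one_le_exp _)
            rw [inv_le_iff_one_le_mul₀]
            · field_simp
              nlinarith [mul_nonneg ha.le (mul_nonneg (mul_pos ha ht0).le (sub_nonneg.2 ht1))]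
            · have : a / (1 + a) < 1 := (div_lt_one (by positivity)).2 (by linarith)
              nlinarith
          · have : a / (1 + a) < 1 := (div_lt_one (by positivity)).2 (by linarith)
            nlinarith
        have h2 := Real.add_one_le_exp (-(c * (a / (1 + a)) * t))
        have h3 := mul_le_mul_of_nonneg_left h1 hc0.le
        linarith
    _ = C * Real.exp (-(c * (a / (1 + a)) * (m : ℝ) ^ α)) := by
        rw [← Real.exp_nat_mul, ← hmt]
        congr 2
        ring

theorem coeff_walk_pow_le (hd : 2 ≤ d) : ∃ C ≥ (1 : ℝ), ∃ c > (0 : ℝ), ∀ n : ℕ,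
    (walk d ^ (2 * n)).coeff 1 ≤ C * Real.exp (-(c * (n : ℝ) ^ ((d : ℝ) / (d + 2)))) := by
  obtain ⟨C, hC, a, ha, hb⟩ := coeff_blockWalk_pow_le hd
  have hd0 : (2 : ℝ) ≤ d := by exact_mod_cast hd
  set α : ℝ := (d : ℝ) / (d + 2) with hα
  have hα0 : 0 < α := by positivity
  have hα1 : α ≤ 1 := (div_le_one (by positivity)).2 (by linarith)
  set k : ℕ := 6 * d + 4 with hk
  set c : ℝ := ((2 * d : ℝ)⁻¹) ^ k with hc
  have hc0 : 0 < c := by positivity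
  have hc1 : c ≤ 1 := pow_le_one₀ (by positivity) (inv_le_one_of_one_le₀ (by linarith))
  have hk0 : (0 : ℝ) < k := by positivity
  set c' : ℝ := c * (a / (1 + a)) with hc'
  have hc'0 : 0 < c' := by positivity
  set c'' : ℝ := c' / (2 * k : ℝ) ^ α with hc''
  have hc''0 : 0 < c'' := by positivity
  have h1 : (1 : ℝ) ≤ Real.exp (c'' * (k : ℝ) ^ α) := Real.one_le_exp (by positivity)
  refine ⟨C * Real.exp (c'' * (k : ℝ) ^ α), by nlinarith, c'', hc''0, fun n => ?_⟩
  rcases Nat.eq_zero_or_pos (n / k) with hq | hq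
  · have hn : n < k := (Nat.div_eq_zero_iff_lt (by omega)).1 hq
    refine (MonoidAlgebra.coeff_pow_one_le_one walk_symm walk_nonneg (mass_walk hd) n).trans ?_
    rw [mul_assoc, ← Real.exp_add]
    have h2 : (n : ℝ) ^ α ≤ (k : ℝ) ^ α :=
      Real.rpow_le_rpow (by positivity) (by exact_mod_cast hn.le) hα0.le
    have h3 : (1 : ℝ) ≤ Real.exp (c'' * (k : ℝ) ^ α + -(c'' * (n : ℝ) ^ α)) :=
      Real.one_le_exp (by nlinarith)
    nlinarith
  · set q := n / k with hqd
    obtain ⟨m, hm⟩ : ∃ m, q = m + 1 := ⟨q - 1, by omega⟩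
    have hqn : k * q ≤ n := Nat.mul_div_le n k
    have hnq : n < k * (q + 1) := Nat.lt_mul_div_succ n (by omega)
    have h2 : (walk d ^ (2 * n)).coeff 1 ≤ (walk d ^ (k * (2 * m + 1))).coeff 1 := by
      have h3 : k * (2 * m + 1) = 2 * ((3 * d + 2) * (2 * m + 1)) := by rw [hk]; ring
      rw [h3]
      refine MonoidAlgebra.coeff_pow_one_antitone walk_symm walk_nonneg (mass_walk hd) ?_
      have h4 : 2 * ((3 * d + 2) * (2 * m + 1)) ≤ 2 * (k * q) := by
        rw [← h3, hm]
        nlinarith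
      omega
    refine h2.trans ((MonoidAlgebra.coeff_pow_one_le_of_smul_le walk_symm blockWalk_symm
      (mass_walk hd) (mass_blockWalk hd) smul_blockWalk_le m).trans ?_)
    refine (binomial_exp_rpow_le (by linarith) ha hc0 hc1 hα0 hα1 hb (by omega)).trans ?_
    have h5 : (n : ℝ) / (2 * k) ≤ ((2 * m + 1 : ℕ) : ℝ) := by
      rw [div_le_iff₀ (by positivity)]
      have : n ≤ (2 * m + 1) * (2 * k) := by
        rw [hm] at hnq
        nlinarith
      exact_mod_cast this
    have h6 : (n : ℝ) ^ α / (2 * k : ℝ) ^ α ≤ ((2 * m + 1 : ℕ) : ℝ) ^ α := by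
      rw [← Real.div_rpow (by positivity) (by positivity)]
      exact Real.rpow_le_rpow (by positivity) h5 hα0.le
    have h7 : Real.exp (-(c' * ((2 * m + 1 : ℕ) : ℝ) ^ α)) ≤ Real.exp (-(c'' * (n : ℝ) ^ α)) := by
      rw [Real.exp_le_exp, hc'', div_mul_eq_mul_div, mul_div_assoc]
      have := mul_le_mul_of_nonneg_left h6 hc'0.le
      linarith
    have h8 := mul_le_mul_of_nonneg_left h7 (by linarith : 0 ≤ C)
    refine h8.trans ?_
    rw [mul_right_comm]
    exact le_mul_of_one_le_right (by positivity) h1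

/-- The box `[-r, r]^d`. -/
noncomputable def box (d r : ℕ) : Finset (Vtx d) := Fintype.piFinset fun _ => Finset.Icc (-(r : ℤ)) r

theorem mem_box {r : ℕ} {x : Vtx d} : x ∈ box d r ↔ ∀ i, -(r : ℤ) ≤ x i ∧ x i ≤ r := by
  simp [box]

theorem card_box (d r : ℕ) : (box d r).card = (2 * r + 1) ^ d := by
  rw [box, Fintype.card_piFinset, Finset.prod_const, Int.card_Icc, Finset.card_univ,
    Fintype.card_fin]
  congr 1
  omega

/-- The probability that simple random walk from `x` makes `n` steps inside the box. -/
noncomputable def stay (r : ℕ) : ℕ → Vtx d → ℝ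
  | 0, _ => 1
  | n + 1, x => (2 * d : ℝ)⁻¹ * ∑ e, if x + vec e ∈ box d r then stay r n (x + vec e) else 0

/-- The configurations reached by walks inside the box. -/
noncomputable def boxPerms (d r : ℕ) : Finset (Equiv.Perm (Vtx d)) := by
  classical
  exact (Finset.univ : Finset (Equiv.Perm (box d r) × box d r)).image fun p =>
    Equiv.Perm.ofSubtype p.1 * Equiv.addRight (p.2 : Vtx d)

theorem card_boxPerms_le (d r : ℕ) :
    (boxPerms d r).card ≤ (box d r).card.factorial * (box d r).card := by
  classical
  refine Finset.card_image_le.trans (le_of_eq ?_)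
  rw [Finset.card_univ, Fintype.card_prod, Fintype.card_perm, Fintype.card_coe]

theorem mul_addRight_mem_boxPerms {r : ℕ} {x : Vtx d} (hx : x ∈ box d r) {h : Equiv.Perm (Vtx d)}
    (hh : ∀ y ∉ box d r, h y = y) : h * Equiv.addRight x ∈ boxPerms d r := by
  classical
  have h1 : ∀ y, h y ∈ box d r ↔ y ∈ box d r := fun y => by
    by_cases hy : y ∈ box d r
    · refine iff_of_true ?_ hy
      by_contra hc
      exact hc (by rwa [h.injective (hh _ hc)])
    · rw [hh y hy]
  refine Finset.mem_image.2 ⟨(h.subtypePerm h1, ⟨x, hx⟩), Finset.mem_univ _, ?_⟩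
  rw [Equiv.Perm.ofSubtype_subtypePerm]
  intro y hy
  by_contra hc
  exact hy (hh y hc)

theorem stay_le (r n : ℕ) {x : Vtx d} (hx : x ∈ box d r) {h : Equiv.Perm (Vtx d)}
    (hh : ∀ y ∉ box d r, h y = y) :
    stay r n x ≤ ∑ g ∈ boxPerms d r, (walk d ^ n).coeff ((h * Equiv.addRight x)⁻¹ * g) := by
  classical
  induction n generalizing x h with
  | zero =>
    have := Finset.single_le_sum (f := fun g =>
      (walk d ^ 0).coeff ((h * Equiv.addRight x)⁻¹ * g))
      (fun g _ => MonoidAlgebra.coeff_pow_nonneg walk_nonneg _ _) (mul_addRight_mem_boxPerms hx hh)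
    refine le_trans (le_of_eq ?_) this
    simp only [inv_mul_cancel, pow_zero]
    rw [coeff_one_apply, if_pos rfl, stay]
  | succ n ih =>
    simp only [coeff_walk_pow_succ]
    rw [← Finset.mul_sum, Finset.sum_comm, stay]
    refine mul_le_mul_of_nonneg_left (Finset.sum_le_sum fun e _ => ?_) (by positivity)
    split_ifs with he
    · have h1 : ∀ y ∉ box d r, (h * Equiv.swap x (x + vec e)) y = y := fun y hy => by
        rw [Equiv.Perm.mul_apply, Equiv.swap_apply_of_ne_of_ne, hh y hy]
        · rintro rfl
          exact hy hx
        · rintro rfl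
          exact hy he
      have h2 := ih he h1
      rw [mul_swap_mul_addRight, mul_inv_rev _ (step e)] at h2
      simpa only [mul_assoc] using h2
    · exact Finset.sum_nonneg fun g _ => MonoidAlgebra.coeff_pow_nonneg walk_nonneg _ _

theorem stay_sq_le (r n : ℕ) :
    stay r n (0 : Vtx d) ^ 2 ≤ (boxPerms d r).card * (walk d ^ (2 * n)).coeff 1 := by
  classical
  have h0 : 0 ≤ stay r n (0 : Vtx d) := by
    cases n with
    | zero => exact zero_le_one
    | succ n =>
      have : ∀ n, ∀ x : Vtx d, 0 ≤ stay r n x := by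
        intro n
        induction n with
        | zero => exact fun _ => zero_le_one
        | succ n ih =>
          refine fun x => mul_nonneg (by positivity) (Finset.sum_nonneg fun e _ => ?_)
          split_ifs
          · exact ih _
          · exact le_rfl
      exact this _ _
  have h1 : stay r n (0 : Vtx d) ≤ ∑ g ∈ boxPerms d r, (walk d ^ n).coeff g := by
    have h2 := stay_le (d := d) r n (x := 0) (h := 1) (mem_box.2 fun i => by simp) fun _ _ => rfl
    have h3 : (1 * Equiv.addRight (0 : Vtx d))⁻¹ = (1 : Equiv.Perm (Vtx d)) := by
      rw [inv_eq_one]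
      ext1 z
      simp
    rw [h3] at h2
    simpa only [one_mul] using h2
  calc stay r n (0 : Vtx d) ^ 2 ≤ (∑ g ∈ boxPerms d r, (walk d ^ n).coeff g) ^ 2 := by gcongr
    _ ≤ (boxPerms d r).card * ∑ g ∈ boxPerms d r, (walk d ^ n).coeff g ^ 2 :=
        sq_sum_le_card_mul_sum_sq
    _ ≤ (boxPerms d r).card * (walk d ^ (2 * n)).coeff 1 := by
        rw [two_mul, pow_add, MonoidAlgebra.coeff_mul_self_one (walk_symm.pow n)]
        refine mul_le_mul_of_nonneg_left ?_ (by positivity)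
        rw [← Finset.sum_filter_ne_zero]
        refine Finset.sum_le_sum_of_subset_of_nonneg (fun g hg => ?_) fun g _ _ => by positivity
        rw [Finsupp.mem_support_iff]
        exact (pow_ne_zero_iff two_ne_zero).1 (Finset.mem_filter.1 hg).2

/-- The principal Dirichlet eigenfunction of the box. -/
noncomputable def cosProd (θ : ℝ) (x : Vtx d) : ℝ := ∏ i, Real.cos (θ * x i)

theorem cosProd_add_vec (θ : ℝ) (x : Vtx d) (i : Fin d) :
    cosProd θ (x + vec (i, true)) + cosProd θ (x + vec (i, false)) =
      2 * (Real.cos θ * cosProd θ x) := by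
  have h : ∀ b, cosProd θ (x + vec (i, b)) = Real.cos (θ * (x i + vec (i, b) i : ℤ)) *
      ∏ j ∈ Finset.univ.erase i, Real.cos (θ * x j) := fun b => by
    rw [cosProd, ← Finset.mul_prod_erase _ _ (Finset.mem_univ i)]
    congr 1
    refine Finset.prod_congr rfl fun j hj => ?_
    have : vec (i, b) j = 0 := by simp [vec, Finset.ne_of_mem_erase hj]
    rw [Pi.add_apply, this, add_zero]
  rw [h, h, cosProd, ← Finset.mul_prod_erase _ _ (Finset.mem_univ i), ← add_mul]
  have h1 : Real.cos (θ * (x i + vec (i, true) i : ℤ)) +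
      Real.cos (θ * (x i + vec (i, false) i : ℤ)) = 2 * (Real.cos θ * Real.cos (θ * x i)) := by
    simp only [vec, Pi.single_eq_same]
    push_cast
    simp only [mul_add, mul_neg, mul_one, Real.cos_add,
      Real.cos_neg, Real.sin_neg]
    ring
  rw [h1]
  ring

theorem sum_cosProd (hd : 0 < d) (θ : ℝ) (x : Vtx d) :
    (2 * d : ℝ)⁻¹ * ∑ e, cosProd θ (x + vec e) = Real.cos θ * cosProd θ x := by
  have hd0 : (0 : ℝ) < d := by exact_mod_cast hd
  simp only [Fintype.sum_prod_type, Fintype.sum_bool, cosProd_add_vec]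
  rw [Finset.sum_const, Finset.card_univ, Fintype.card_fin, nsmul_eq_mul]
  field_simp

theorem cos_pow_mul_cosProd_le_stay (hd : 0 < d) (r n : ℕ) {x : Vtx d} (hx : x ∈ box d r) :
    Real.cos (Real.pi / (2 * (r + 1))) ^ n * cosProd (Real.pi / (2 * (r + 1))) x ≤ stay r n x := by
  set θ := Real.pi / (2 * (r + 1) : ℝ) with hθ
  have hθ0 : θ * (r + 1) = Real.pi / 2 := by
    rw [hθ]
    field_simp
  have hθp : 0 < θ := by positivity
  have hcos : 0 ≤ Real.cos θ := Real.cos_nonneg_of_neg_pi_div_two_le_of_le (by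
    linarith [Real.pi_pos]) (by nlinarith [(Nat.cast_nonneg r : (0 : ℝ) ≤ r)])
  have hle : ∀ y : Vtx d, cosProd θ y ≤ 1 := fun y => by
    refine (le_abs_self _).trans ?_
    rw [cosProd, Finset.abs_prod]
    exact Finset.prod_le_one (fun _ _ => abs_nonneg _) fun _ _ => Real.abs_cos_le_one _
  induction n generalizing x with
  | zero => simpa [stay] using hle x
  | succ n ih =>
    rw [pow_succ, mul_assoc, ← sum_cosProd hd, mul_left_comm, stay, Finset.mul_sum]
    refine mul_le_mul_of_nonneg_left (Finset.sum_le_sum fun e _ => ?_) (by positivity)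
    split_ifs with he
    · exact ih he
    · have h0 : cosProd θ (x + vec e) = 0 := by
        rw [mem_box] at he hx
        push Not at he
        obtain ⟨i, hi⟩ := he
        refine Finset.prod_eq_zero (Finset.mem_univ i) ?_
        have h1 := hx i
        have h2 : (x + vec e) i = x i + vec e i := rfl
        have h3 : vec e i = 0 ∨ vec e i = 1 ∨ vec e i = -1 := by
          by_cases hi' : i = e.1
          · subst hi'
            cases hb : e.2 <;> simp [vec, hb]
          · simp [vec, hi']
        have h4 : (x + vec e) i = r + 1 ∨ (x + vec e) i = -(r + 1) := by
          rw [h2] at hi ⊢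
          omega
        rcases h4 with h4 | h4
        · rw [h4]
          push_cast
          rw [hθ0, Real.cos_pi_div_two]
        · rw [h4]
          push_cast
          rw [mul_neg, Real.cos_neg, hθ0, Real.cos_pi_div_two]
      rw [h0, mul_zero]

theorem exp_le_stay (hd : 0 < d) {r : ℕ} (hr : 0 < r) (n : ℕ) :
    Real.exp (-(4 * n / (r + 1 : ℝ) ^ 2)) ≤ stay r n (0 : Vtx d) := by
  have h := cos_pow_mul_cosProd_le_stay hd r n (x := 0) (mem_box.2 fun i => by simp)
  rw [cosProd, Finset.prod_eq_one (fun i _ => by simp), mul_one] at h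
  refine le_trans ?_ h
  have hr1 : (1 : ℝ) ≤ r := by exact_mod_cast hr
  set θ := Real.pi / (2 * (r + 1) : ℝ) with hθ
  have hθ0 : 0 ≤ θ := by positivity
  have hθ2 : θ ≤ 2 / (r + 1) := by
    rw [hθ, div_le_div_iff₀ (by positivity) (by positivity)]
    nlinarith [Real.pi_le_four]
  have hθ1 : θ ≤ 1 := hθ2.trans ((div_le_one (by positivity)).2 (by linarith))
  have hθs : θ ^ 2 ≤ 4 / (r + 1) ^ 2 := by
    calc θ ^ 2 ≤ (2 / (r + 1)) ^ 2 := by gcongr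
      _ = _ := by rw [div_pow]; norm_num
  have h1 : Real.exp (-θ ^ 2) ≤ Real.cos θ := by
    refine le_trans ?_ (Real.one_sub_sq_div_two_le_cos)
    have hs : θ ^ 2 ≤ 1 := pow_le_one₀ hθ0 hθ1
    have hs0 : 0 ≤ θ ^ 2 := sq_nonneg θ
    rw [Real.exp_neg, inv_le_comm₀ (Real.exp_pos _) (by linarith)]
    refine le_trans ?_ (Real.add_one_le_exp _)
    rw [inv_le_iff_one_le_mul₀ (by linarith)]
    nlinarith
  calc Real.exp (-(4 * n / (r + 1 : ℝ) ^ 2)) ≤ Real.exp (-θ ^ 2) ^ n := by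
        rw [← Real.exp_nat_mul, Real.exp_le_exp]
        have := mul_le_mul_of_nonneg_left hθs (Nat.cast_nonneg n : (0 : ℝ) ≤ n)
        rw [mul_div_assoc, mul_div_left_comm]
        linarith
    _ ≤ _ := by gcongr

theorem exp_le_coeff_walk_pow (hd : 0 < d) {r : ℕ} (hr : 0 < r) (n : ℕ) :
    Real.exp (-(8 * n / (r + 1 : ℝ) ^ 2 + 2 * (2 * (r + 1)) ^ d * (d * Real.log (2 * (r + 1))))) ≤
      (walk d ^ (2 * n)).coeff 1 := by
  set V : ℕ := (box d r).card with hV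
  have hV1 : 1 ≤ V := by
    rw [hV, card_box]
    exact Nat.one_le_pow _ _ (by omega)
  have hV1' : (1 : ℝ) ≤ V := by exact_mod_cast hV1
  have hV2 : (V : ℝ) ≤ (2 * (r + 1)) ^ d := by
    rw [hV, card_box]
    push_cast
    gcongr
    linarith
  have hΩ : ((boxPerms d r).card : ℝ) ≤
      Real.exp (2 * (2 * (r + 1)) ^ d * (d * Real.log (2 * (r + 1)))) := by
    calc ((boxPerms d r).card : ℝ) ≤ ((V.factorial * V : ℕ) : ℝ) := by
          exact_mod_cast card_boxPerms_le d r
      _ ≤ ((V ^ V * V ^ V : ℕ) : ℝ) := by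
          have h1 : V.factorial ≤ V ^ V := Nat.factorial_le_pow V
          have h2 : V ≤ V ^ V := Nat.le_self_pow (by omega) V
          exact_mod_cast Nat.mul_le_mul h1 h2
      _ = Real.exp (2 * V * Real.log V) := by
          push_cast
          rw [← pow_add, ← two_mul, mul_comm _ (Real.log _), Real.exp_mul,
            Real.exp_log (by linarith), ← Real.rpow_natCast]
          push_cast
          rfl
      _ ≤ _ := by
          have h3 : Real.log V ≤ d * Real.log (2 * (r + 1)) := by
            rw [← Real.log_pow]
            exact Real.log_le_log (by linarith) hV2
          have h4 : 0 ≤ Real.log V := Real.log_nonneg hV1'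
          gcongr
  have hs := exp_le_stay hd hr n
  have hp : 0 ≤ (walk d ^ (2 * n)).coeff 1 := MonoidAlgebra.coeff_pow_nonneg walk_nonneg _ _
  have h5 : Real.exp (-(8 * n / (r + 1 : ℝ) ^ 2)) ≤
      Real.exp (2 * (2 * (r + 1)) ^ d * (d * Real.log (2 * (r + 1)))) *
        (walk d ^ (2 * n)).coeff 1 := by
    refine le_trans ?_ ((stay_sq_le r n).trans (mul_le_mul_of_nonneg_right hΩ hp))
    calc _ = Real.exp (-(4 * n / (r + 1 : ℝ) ^ 2)) ^ 2 := by
          rw [← Real.exp_nat_mul]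
          congr 1
          push_cast
          ring
      _ ≤ _ := by gcongr
  rw [neg_add, Real.exp_add, Real.exp_neg (2 * _ * _), ← div_eq_mul_inv,
    div_le_iff₀ (Real.exp_pos _), mul_comm ((walk d ^ (2 * n)).coeff 1)]
  exact h5

theorem exp_rpow_log_le_coeff_walk_pow (hd : 2 ≤ d) : ∃ C > (0 : ℝ), ∀ n : ℕ,
    Real.exp (-(C * (n : ℝ) ^ ((d : ℝ) / (d + 2)) *
      Real.log ((n : ℝ) + 2) ^ ((2 : ℝ) / (d + 2)))) ≤ (walk d ^ (2 * n)).coeff 1 := by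
  classical
  have hd0 : (2 : ℝ) ≤ d := by exact_mod_cast hd
  refine ⟨8 + 8 * d * 10 ^ d, by positivity, fun n => ?_⟩
  rcases Nat.eq_zero_or_pos n with rfl | hn
  · rw [Nat.cast_zero, Real.zero_rpow (by positivity), mul_zero, zero_mul, neg_zero, Real.exp_zero,
      mul_zero, pow_zero, coeff_one_apply, if_pos rfl]
  · have hn1 : (1 : ℝ) ≤ n := by exact_mod_cast hn
    set L := Real.log ((n : ℝ) + 2) with hL
    have hL1 : 1 ≤ L := by
      rw [hL, Real.le_log_iff_exp_le (by linarith)]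
      linarith [Real.exp_one_lt_three]
    have hL0 : 0 < L := by linarith
    have hL2 : L ≤ 2 * n := by
      have := Real.log_le_sub_one_of_pos (by linarith : (0 : ℝ) < n + 2)
      linarith
    set s : ℝ := (n / L) ^ ((1 : ℝ) / (d + 2)) with hs
    have hs0 : 0 < s := by positivity
    have hα : (1 : ℝ) / (d + 2) ≤ 1 := (div_le_one (by positivity)).2 (by linarith)
    have hα0 : (0 : ℝ) < 1 / (d + 2) := by positivity
    have hsh : 1 / 2 ≤ s := by
      calc (1 / 2 : ℝ) = (1 / 2) ^ (1 : ℝ) := (Real.rpow_one _).symm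
        _ ≤ (1 / 2) ^ ((1 : ℝ) / (d + 2)) :=
            Real.rpow_le_rpow_of_exponent_ge (by norm_num) (by norm_num) hα
        _ ≤ s := Real.rpow_le_rpow (by norm_num)
            (by rw [div_le_div_iff₀ (by norm_num) hL0]; linarith) hα0.le
    have hsn : s ≤ n := by
      calc s ≤ (n : ℝ) ^ ((1 : ℝ) / (d + 2)) :=
            Real.rpow_le_rpow (by positivity) (div_le_self (by linarith) hL1) hα0.le
        _ ≤ (n : ℝ) ^ (1 : ℝ) := Real.rpow_le_rpow_of_exponent_le hn1 hα
        _ = n := Real.rpow_one _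
    have hsp : s ^ (d + 2) = n / L := by
      rw [hs, ← Real.rpow_natCast, ← Real.rpow_mul (by positivity)]
      push_cast
      rw [one_div_mul_cancel (by positivity), Real.rpow_one]
    have hsd : s ^ d * L = (n : ℝ) ^ ((d : ℝ) / (d + 2)) * L ^ ((2 : ℝ) / (d + 2)) := by
      rw [hs, ← Real.rpow_natCast, ← Real.rpow_mul (by positivity),
        show (1 : ℝ) / (d + 2) * d = d / (d + 2) by ring,
        Real.div_rpow (by positivity) hL0.le, div_mul_eq_mul_div, mul_div_assoc]
      congr 1
      rw [show (2 : ℝ) / (d + 2) = 1 - d / (d + 2) by field_simp; ring, Real.rpow_sub hL0,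
        Real.rpow_one]
    have hns : (n : ℝ) / s ^ 2 = s ^ d * L := by
      rw [div_eq_iff (by positivity), mul_right_comm, ← pow_add, hsp, div_mul_cancel₀ _ hL0.ne']
    have hr : 0 < ⌈s⌉₊ := Nat.ceil_pos.2 hs0
    have hr1 : s ≤ ⌈s⌉₊ := Nat.le_ceil s
    have hr2 : (⌈s⌉₊ : ℝ) < s + 1 := Nat.ceil_lt_add_one hs0.le
    refine le_trans ?_ (exp_le_coeff_walk_pow (by omega) hr n)
    rw [Real.exp_le_exp, neg_le_neg_iff, mul_assoc (8 + 8 * d * 10 ^ d : ℝ), ← hsd]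
    set ρ : ℝ := (⌈s⌉₊ : ℝ) + 1 with hρ
    have hρ1 : 2 * ρ ≤ 10 * s := by linarith
    have hlog : Real.log (2 * ρ) ≤ 4 * L := by
      rw [hL, show (4 : ℝ) = (4 : ℕ) by norm_num, ← Real.log_pow]
      refine Real.log_le_log (by linarith) ?_
      have : (27 : ℝ) * (n + 2) ≤ (n + 2) ^ 4 := by
        have : (3 : ℝ) ^ 3 ≤ (n + 2) ^ 3 := by
          gcongr
          linarith
        nlinarith
      linarith
    have hlog0 : 0 ≤ Real.log (2 * ρ) := Real.log_nonneg (by linarith)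
    have h1 : 8 * (n : ℝ) / ρ ^ 2 ≤ 8 * (s ^ d * L) := by
      rw [mul_div_assoc, ← hns]
      have : s ≤ ρ := by linarith
      gcongr
    have h2 : 2 * (2 * ρ) ^ d * (d * Real.log (2 * ρ)) ≤ 2 * (10 * s) ^ d * (d * (4 * L)) := by
      gcongr
    rw [mul_pow 10] at h2
    linarith

end Umpteen

/-- **Theorem (return probability of the fifteen puzzle on `ℤ^d`).**
For every `d ≥ 2` there are `C, c > 0` such that for all `n ≥ 0`,
`c·exp(−C·n^{d/(d+2)}·(log(n+2))^{2/(d+2)}) ≤ p_{2n}(ℤ^d) ≤ C·exp(−c·n^{d/(d+2)})`,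
where `p_{2n}(ℤ^d) = T_{2n}(d)/(2d)^{2n}`. -/
theorem umpteen_return_probability (d : ℕ) (hd : 2 ≤ d) :
    ∃ C > (0 : ℝ), ∃ c > (0 : ℝ), ∀ n : ℕ,
      c * Real.exp (-(C * (n : ℝ) ^ ((d : ℝ) / (d + 2)) *
          Real.log ((n : ℝ) + 2) ^ ((2 : ℝ) / (d + 2))))
        ≤ (T (2 * n) d : ℝ) / (2 * d) ^ (2 * n) ∧
      (T (2 * n) d : ℝ) / (2 * d) ^ (2 * n)
        ≤ C * Real.exp (-(c * (n : ℝ) ^ ((d : ℝ) / (d + 2)))) := by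
  obtain ⟨C₁, hC₁, h₁⟩ := Umpteen.exp_rpow_log_le_coeff_walk_pow hd
  obtain ⟨C₂, hC₂, c₂, hc₂, h₂⟩ := Umpteen.coeff_walk_pow_le hd
  refine ⟨max C₁ C₂, lt_max_of_lt_left hC₁, min 1 c₂, lt_min one_pos hc₂, fun n => ?_⟩
  have hL : 0 ≤ Real.log ((n : ℝ) + 2) :=
    Real.log_nonneg (by linarith [(Nat.cast_nonneg n : (0 : ℝ) ≤ n)])
  rw [Umpteen.T_div_eq hd]
  constructor
  · refine le_trans ?_ (h₁ n)
    refine (mul_le_of_le_one_left (Real.exp_pos _).le (min_le_left _ _)).trans ?_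
    gcongr
    exact le_max_left _ _
  · refine (h₂ n).trans ?_
    gcongr
    · exact le_max_right _ _
    · exact min_le_right _ _
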